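/- (Rynne–Dickinson) Let m ≥ 1 and τ1 ≥ τ2 ≥ ⋯ ≥ τm > 0 with τ1 + ⋯ + τm > 1. Then dim_H A_m(Ψ_τ) = min_{1 ≤ i ≤ m} ( m + 1 + Σ_{k=i}^{m} (τ_i − τ_k) ) / (1 + τ_i). -/

import Mathlib

open MeasureTheory Set

noncomputable section

/-- The set of Ψ-approximable vectors in `[0,1]^m`: points `x` such that for infinitely many
positive integers `q` there exists `p ∈ ℤ^m` with `|q * x i - p i| < Ψ q i` for all `i`. -/
def approxSet (m : ℕ) (Ψ : ℕ → Fin m → ℝ) : Set (Fin m → ℝ) :=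
  {x | (∀ i, x i ∈ Set.Icc (0:ℝ) 1) ∧
    {q : ℕ | 0 < q ∧ ∃ p : Fin m → ℤ,
      ∀ i, |(q : ℝ) * x i - (p i : ℝ)| < Ψ q i}.Infinite}

/-- The set of weighted Ψ-badly approximable vectors:
`B_m(Ψ) = A_m(Ψ) \ ⋂_{0<c<1} A_m(cΨ)`. -/
def badSet (m : ℕ) (Ψ : ℕ → Fin m → ℝ) : Set (Fin m → ℝ) :=
  approxSet m Ψ \ ⋂ c ∈ Set.Ioo (0:ℝ) 1, approxSet m (fun q i => c * Ψ q i)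

/-- The power-law approximation function `Ψ_τ`, with `ψ_i(q) = q^{-τ_i}`. -/
def psiTau (m : ℕ) (τ : Fin m → ℝ) : ℕ → Fin m → ℝ :=
  fun q i => (q : ℝ) ^ (-(τ i))

/-- A piecewise affine convex function that is nonnegative at its breakpoints and ends. -/
lemma mul_le_add_sum_max {m : ℕ} {τ : Fin m → ℝ} {s ρ : ℝ} (hρ : -1 ≤ ρ) (hsm : s ≤ m)
    (h : ∀ i, s * (1 + τ i) ≤ m + 1 + ∑ k, max (τ i - τ k) 0) :
    s * (1 + ρ) ≤ m + 1 + ∑ k, max (ρ - τ k) 0 := by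
  classical
  set A : Finset (Fin m) := Finset.univ.filter (fun k => τ k ≤ ρ) with hA
  have hmem : ∀ k, k ∈ A ↔ τ k ≤ ρ := fun k => by simp [hA]
  have key : ∀ t : ℝ, (∀ k ∈ A, τ k ≤ t) → (∀ k ∉ A, t ≤ τ k) →
      ∑ k, max (t - τ k) 0 = A.card * t - ∑ k ∈ A, τ k := by
    intro t h1 h2
    have : ∑ k ∈ A, (t - τ k) = A.card * t - ∑ k ∈ A, τ k := by
      simp [Finset.sum_sub_distrib]
    rw [← this, ← Finset.sum_subset (Finset.subset_univ A)]
    · exact Finset.sum_congr rfl fun k hk => max_eq_left (by linarith [h1 k hk])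
    · intro k _ hk
      exact max_eq_right (by linarith [h2 k hk])
  have hρA := key ρ (fun k hk => (hmem k).1 hk) (fun k hk => by
    have := mt (hmem k).2 hk; linarith)
  rw [hρA]
  rcases le_total s A.card with hs | hs
  · rcases A.eq_empty_or_nonempty with hE | hne
    · rw [hE] at hs ⊢
      simp only [Finset.card_empty, Nat.cast_zero, Finset.sum_empty] at hs ⊢
      have : s * (1 + ρ) ≤ 0 := mul_nonpos_of_nonpos_of_nonneg hs (by linarith)
      have : (0 : ℝ) ≤ m := Nat.cast_nonneg m
      linarith
    · obtain ⟨i, hi, hmax⟩ := A.exists_max_image τ hne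
      have h1 := h i
      rw [key (τ i) hmax (fun k hk => by
        have := mt (hmem k).2 hk; have := (hmem i).1 hi; linarith)] at h1
      nlinarith [(hmem i).1 hi]
  · rcases Aᶜ.eq_empty_or_nonempty with hE | hne
    · have hAu : A = Finset.univ := by simpa using hE
      have hcard : (A.card : ℝ) = m := by rw [hAu]; simp
      have hsum : ∑ k ∈ A, τ k ≤ A.card * ρ := by
        simpa using Finset.sum_le_card_nsmul A τ ρ (fun k hk => (hmem k).1 hk)
      have hs' : s = m := le_antisymm hsm (hcard ▸ hs)
      have hne : A.Nonempty ∨ m = 0 := by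
        rcases Nat.eq_zero_or_pos m with h0 | h0
        · exact Or.inr h0
        · left; rw [hAu]; exact ⟨⟨0, h0⟩, Finset.mem_univ _⟩
      rcases hne with hne | h0
      · obtain ⟨i, hi, hmax⟩ := A.exists_max_image τ hne
        have h1 := h i
        rw [key (τ i) hmax (fun k hk => by simp [hAu] at hk)] at h1
        rw [hcard, hs'] at *
        nlinarith
      · subst h0
        rw [hcard, hs']
        simp [hAu]
    · obtain ⟨i, hi, hmin⟩ := Aᶜ.exists_min_image τ hne
      have hi' : ρ < τ i := by
        have := mt (hmem i).2 (Finset.mem_compl.1 hi); linarith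
      have h1 := h i
      rw [key (τ i) (fun k hk => by have := (hmem k).1 hk; linarith)
        (fun k hk => hmin k (Finset.mem_compl.2 hk))] at h1
      nlinarith

lemma prod_max_min_le {m : ℕ} {τ : Fin m → ℝ} {s α : ℝ} (hsm : s ≤ m)
    (h : ∀ i, s * (1 + τ i) ≤ m + 1 + ∑ k, max (τ i - τ k) 0)
    (hα : ∑ k, min α (τ k) = 1) {N r : ℝ} (hN : 1 < N) (hr : 0 < r) (hr1 : r ≤ 1) :
    N ^ (-(m + 1 : ℝ)) * ∏ k, (max (r * N ^ (1 + min α (τ k))) 1 * min 1 (r * N ^ (1 + τ k)))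
      ≤ r ^ s := by
  have hN0 : 0 < N := by linarith
  obtain ⟨ρ, rfl⟩ : ∃ ρ : ℝ, r = N ^ (-(1 + ρ)) := by
    refine ⟨-Real.logb N r - 1, ?_⟩
    rw [show -(1 + (-Real.logb N r - 1)) = Real.logb N r by ring,
      Real.rpow_logb hN0 hN.ne' hr]
  have hρ : -1 ≤ ρ := by
    have := (Real.rpow_le_one_iff_of_pos hN0).1 hr1
    rcases this with ⟨_, h2⟩ | ⟨h1, _⟩ <;> linarith
  have e1 : ∀ x : ℝ, max (N ^ (-(1 + ρ)) * N ^ (1 + x)) 1 = N ^ (max (x - ρ) 0) := by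
    intro x
    rw [← Real.rpow_add hN0, show -(1 + ρ) + (1 + x) = x - ρ by ring]
    rcases le_total (x - ρ) 0 with hx | hx
    · rw [max_eq_right hx, Real.rpow_zero, max_eq_right]
      exact Real.rpow_le_one_of_one_le_of_nonpos hN.le hx
    · rw [max_eq_left hx, max_eq_left]
      exact Real.one_le_rpow hN.le hx
  have e2 : ∀ x : ℝ, min 1 (N ^ (-(1 + ρ)) * N ^ (1 + x)) = N ^ (-(max (ρ - x) 0)) := by
    intro x
    rw [← Real.rpow_add hN0, show -(1 + ρ) + (1 + x) = -(ρ - x) by ring]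
    rcases le_total (ρ - x) 0 with hx | hx
    · rw [max_eq_right hx, neg_zero, Real.rpow_zero, min_eq_left]
      exact Real.one_le_rpow hN.le (by linarith)
    · rw [max_eq_left hx, min_eq_right]
      exact Real.rpow_le_one_of_one_le_of_nonpos hN.le (by linarith)
  simp only [e1, e2]
  simp only [← Real.rpow_add hN0]
  rw [← Real.rpow_sum_of_pos hN0, ← Real.rpow_add hN0, ← Real.rpow_mul hN0.le]
  refine Real.rpow_le_rpow_of_exponent_le hN.le ?_
  suffices s * (1 + ρ) ≤ m + 1 - ∑ k, (max (min α (τ k) - ρ) 0 + -max (ρ - τ k) 0) by linarith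
  rcases le_total ρ α with hρα | hρα
  · have : ∑ k, (max (min α (τ k) - ρ) 0 + -max (ρ - τ k) 0) = 1 - m * ρ := by
      rw [← hα, show (m : ℝ) * ρ = ∑ _k : Fin m, ρ by simp, ← Finset.sum_sub_distrib]
      refine Finset.sum_congr rfl fun k _ => ?_
      rcases le_total α (τ k) with hk | hk
      · rw [min_eq_left hk, max_eq_left (by linarith), max_eq_right (by linarith)]; ring
      · rw [min_eq_right hk]
        rcases le_total ρ (τ k) with hk' | hk'
        · rw [max_eq_left (by linarith), max_eq_right (by linarith)]; ring
        · rw [max_eq_right (by linarith), max_eq_left (by linarith)]; ring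
    rw [this]
    nlinarith
  · have h1 := mul_le_add_sum_max hρ hsm h
    have : ∑ k, (max (min α (τ k) - ρ) 0 + -max (ρ - τ k) 0) = -∑ k, max (ρ - τ k) 0 := by
      rw [← Finset.sum_neg_distrib]
      refine Finset.sum_congr rfl fun k _ => ?_
      rw [max_eq_right (by have := min_le_left α (τ k); linarith), zero_add]
    linarith

lemma exists_sum_min_eq_one {m : ℕ} {τ : Fin m → ℝ} (hpos : ∀ i, 0 < τ i)
    (hsum : 1 < ∑ i, τ i) : ∃ α, 0 < α ∧ ∑ k, min α (τ k) = 1 := by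
  have hcont : Continuous fun α : ℝ => ∑ k, min α (τ k) := by fun_prop
  have hτ : ∀ k, τ k ≤ ∑ i, τ i := fun k =>
    Finset.single_le_sum (fun i _ => (hpos i).le) (Finset.mem_univ k)
  have h0 : ∑ k, min 0 (τ k) = 0 := Finset.sum_eq_zero fun k _ => min_eq_left (hpos k).le
  have h1 : ∑ k, min (∑ i, τ i) (τ k) = ∑ i, τ i :=
    Finset.sum_congr rfl fun k _ => min_eq_right (hτ k)
  obtain ⟨α, hα, hα'⟩ := intermediate_value_Icc (by linarith : (0 : ℝ) ≤ ∑ i, τ i)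
    hcont.continuousOn (show (1 : ℝ) ∈ _ by
      simp only [h0, h1]; exact ⟨zero_le_one, hsum.le⟩)
  refine ⟨α, lt_of_le_of_ne hα.1 ?_, hα'⟩
  rintro rfl
  simp only [h0] at hα'
  exact zero_ne_one hα'

/-- Dirichlet's theorem with weights. -/
lemma exists_nat_forall_abs_mul_sub_le {m : ℕ} {a : Fin m → ℝ} (ha : ∀ k, 0 ≤ a k)
    (hsum : ∑ k, a k = 1) {N : ℕ} (hN : 1 ≤ N) (x : Fin m → ℝ) :
    ∃ q : ℕ, 1 ≤ q ∧ q ≤ N ∧ ∃ p : Fin m → ℤ,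
      ∀ k, |(q : ℝ) * x k - p k| ≤ 2 * (N : ℝ) ^ (-a k) := by
  have hN1 : (1 : ℝ) ≤ N := by exact_mod_cast hN
  have hN0 : (0 : ℝ) < N := by linarith
  set n : Fin m → ℕ := fun k => ⌊(N : ℝ) ^ a k⌋₊ with hn
  have hy : ∀ k, 1 ≤ (N : ℝ) ^ a k := fun k => Real.one_le_rpow hN1 (ha k)
  have hn1 : ∀ k, 1 ≤ n k := fun k => Nat.le_floor (by simpa using hy k)
  have hle : ∀ k, (n k : ℝ) ≤ (N : ℝ) ^ a k := fun k => Nat.floor_le (by linarith [hy k])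
  have hge : ∀ k, (N : ℝ) ^ a k ≤ 2 * n k := fun k => by
    have h1 := Nat.lt_floor_add_one ((N : ℝ) ^ a k)
    have h2 : (1 : ℝ) ≤ n k := by exact_mod_cast hn1 k
    simp only [hn] at h2 ⊢
    linarith
  have hcard : ∏ k, n k ≤ N := by
    have : (∏ k, (n k : ℝ)) ≤ N := by
      calc (∏ k, (n k : ℝ)) ≤ ∏ k, (N : ℝ) ^ a k :=
            Finset.prod_le_prod (fun k _ => Nat.cast_nonneg _) (fun k _ => hle k)
        _ = N := by rw [← Real.rpow_sum_of_pos hN0, hsum, Real.rpow_one]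
    exact_mod_cast this
  let f : ℕ → Fin m → ℕ := fun q k => ⌊Int.fract ((q : ℝ) * x k) * n k⌋₊
  have hmaps : ∀ q ∈ Finset.range (N + 1), f q ∈ Fintype.piFinset fun k => Finset.range (n k) := by
    intro q _
    rw [Fintype.mem_piFinset]
    intro k
    rw [Finset.mem_range, Nat.floor_lt (by have := Int.fract_nonneg ((q : ℝ) * x k); positivity)]
    have h2 : (1 : ℝ) ≤ n k := by exact_mod_cast hn1 k
    nlinarith [Int.fract_lt_one ((q : ℝ) * x k)]
  obtain ⟨u, hu, v, hv, huv, hf⟩ := Finset.exists_ne_map_eq_of_card_lt_of_maps_to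
    (by simp [Fintype.card_piFinset]; omega) hmaps
  wlog hlt : v < u generalizing u v
  · exact this v hv u hu huv.symm hf.symm (by omega)
  refine ⟨u - v, by omega, by simp at hu; omega, fun k => ⌊(u : ℝ) * x k⌋ - ⌊(v : ℝ) * x k⌋, ?_⟩
  intro k
  have hk : ⌊Int.fract ((u : ℝ) * x k) * n k⌋₊ = ⌊Int.fract ((v : ℝ) * x k) * n k⌋₊ :=
    congrFun hf k
  have h2 : (1 : ℝ) ≤ n k := by exact_mod_cast hn1 k
  have hu0 := Int.fract_nonneg ((u : ℝ) * x k)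
  have hv0 := Int.fract_nonneg ((v : ℝ) * x k)
  have a1 := Nat.floor_le (show 0 ≤ Int.fract ((u : ℝ) * x k) * n k by positivity)
  have a2 := Nat.lt_floor_add_one (Int.fract ((u : ℝ) * x k) * n k)
  have b1 := Nat.floor_le (show 0 ≤ Int.fract ((v : ℝ) * x k) * n k by positivity)
  have b2 := Nat.lt_floor_add_one (Int.fract ((v : ℝ) * x k) * n k)
  rw [hk] at a1 a2
  have hd : |Int.fract ((u : ℝ) * x k) - Int.fract ((v : ℝ) * x k)| * n k ≤ 1 := by
    rw [← abs_of_pos (show (0 : ℝ) < n k by linarith), ← abs_mul, abs_le]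
    constructor <;> linarith
  have heq : ((u - v : ℕ) : ℝ) * x k - ((⌊(u : ℝ) * x k⌋ - ⌊(v : ℝ) * x k⌋ : ℤ) : ℝ) =
      Int.fract ((u : ℝ) * x k) - Int.fract ((v : ℝ) * x k) := by
    rw [Nat.cast_sub hlt.le]
    push_cast
    simp only [Int.fract]
    ring
  rw [heq, Real.rpow_neg hN0.le, ← div_eq_mul_inv, le_div_iff₀ (by linarith [hy k])]
  have := abs_nonneg (Int.fract ((u : ℝ) * x k) - Int.fract ((v : ℝ) * x k))
  nlinarith [hge k]

lemma volume_pi_closedBall_eq {m : ℕ} (z : Fin m → ℝ) {g : Fin m → ℝ} (hg : ∀ k, 0 ≤ g k) :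
    volume (univ.pi fun k => Metric.closedBall (z k) (g k)) =
      ENNReal.ofReal (∏ k, (2 * g k)) := by
  rw [volume_pi_pi, ENNReal.ofReal_prod_of_nonneg (fun k _ => by have := hg k; positivity)]
  simp [Real.volume_closedBall]

lemma pow_le_sum_prod_of_subset {m : ℕ} {y : Fin m → ℝ} {r : ℝ} (hr : 0 ≤ r) {ι : Type*}
    (I : Finset ι) (z g : ι → Fin m → ℝ) (hg : ∀ i ∈ I, ∀ k, 0 ≤ g i k)
    (h : (univ.pi fun k => Metric.closedBall (y k) r) ⊆
      ⋃ i ∈ I, univ.pi fun k => Metric.closedBall (z i k) (g i k)) :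
    (2 * r) ^ m ≤ ∑ i ∈ I, ∏ k, (2 * g i k) := by
  have h1 := (measure_mono (μ := volume) h).trans (measure_biUnion_finset_le I _)
  rw [volume_pi_closedBall_eq y (fun _ => hr), Finset.sum_congr rfl
    (fun i hi => volume_pi_closedBall_eq (z i) (hg i hi)),
    ← ENNReal.ofReal_sum_of_nonneg] at h1
  · rw [ENNReal.ofReal_le_ofReal_iff] at h1
    · simpa using h1
    · exact Finset.sum_nonneg fun i hi => Finset.prod_nonneg fun k _ => by
        have := hg i hi k; positivity
  · exact fun i hi => Finset.prod_nonneg fun k _ => by have := hg i hi k; positivity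

lemma Finset.exists_maximal_separated {X : Type*} (T : Finset X) (R : X → X → Prop)
    (hrefl : ∀ x, R x x) (hsymm : ∀ x y, R x y → R y x) :
    ∃ S ⊆ T, (∀ x ∈ S, ∀ y ∈ S, x ≠ y → ¬ R x y) ∧ ∀ x ∈ T, ∃ y ∈ S, R x y := by
  classical
  induction T using Finset.induction_on with
  | empty => exact ⟨∅, by simp⟩
  | insert x T hx ih =>
    obtain ⟨S, hST, hsep, hmax⟩ := ih
    by_cases h : ∃ y ∈ S, R x y
    · refine ⟨S, hST.trans (Finset.subset_insert _ _), hsep, fun u hu => ?_⟩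
      rcases Finset.mem_insert.1 hu with rfl | hu
      · exact h
      · exact hmax u hu
    · push Not at h
      refine ⟨insert x S, Finset.insert_subset_insert _ hST, fun u hu v hv huv => ?_,
        fun u hu => ?_⟩
      · rcases Finset.mem_insert.1 hu with rfl | hu' <;>
          rcases Finset.mem_insert.1 hv with rfl | hv'
        · exact absurd rfl huv
        · exact h v hv'
        · exact fun h' => h u hu' (hsymm _ _ h')
        · exact hsep u hu' v hv' huv
      · rcases Finset.mem_insert.1 hu with rfl | hu
        · exact ⟨u, Finset.mem_insert_self _ _, hrefl u⟩
        · obtain ⟨v, hv, h'⟩ := hmax u hu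
          exact ⟨v, Finset.mem_insert_of_mem hv, h'⟩

lemma card_Icc_ceil_floor_le {u v : ℝ} (h : u ≤ v) :
    ((Finset.Icc ⌈u⌉ ⌊v⌋).card : ℝ) ≤ v - u + 1 := by
  rw [Int.card_Icc]
  have h1 : (((⌊v⌋ + 1 - ⌈u⌉).toNat : ℤ) : ℝ) = max ((⌊v⌋ : ℝ) + 1 - ⌈u⌉) 0 := by
    rw [Int.toNat_eq_max]; push_cast; rfl
  rw [Int.cast_natCast] at h1
  rw [h1]
  exact max_le (by linarith [Int.floor_le v, Int.le_ceil u]) (by linarith)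

lemma sum_add_div_pow_le (m : ℕ) {ℓ κ N : ℝ} (hℓ : 0 < ℓ) (hN : 0 ≤ κ * N) :
    ∑ q ∈ Finset.Ico 1 ⌈κ * N⌉₊, (ℓ + 5 / q) ^ m ≤
      κ * N * (2 * ℓ) ^ m + ⌈5 / ℓ⌉₊ * (ℓ + 5) ^ m := by
  have h1 : ∀ q ∈ Finset.Ico 1 ⌈κ * N⌉₊, (ℓ + 5 / (q : ℝ)) ^ m ≤
      (2 * ℓ) ^ m + if q ∈ Finset.range ⌈5 / ℓ⌉₊ then (ℓ + 5) ^ m else 0 := by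
    intro q hq
    have hq1 : (1 : ℝ) ≤ q := by exact_mod_cast (Finset.mem_Ico.1 hq).1
    split_ifs with h
    · have : (ℓ + 5 / (q : ℝ)) ^ m ≤ (ℓ + 5) ^ m := by
        gcongr
        exact div_le_self (by norm_num) hq1
      have : 0 ≤ (2 * ℓ) ^ m := by positivity
      linarith
    · rw [add_zero]
      rw [Finset.mem_range, not_lt] at h
      have h2 : 5 / ℓ ≤ q := (Nat.le_ceil _).trans (by exact_mod_cast h)
      rw [div_le_iff₀ hℓ] at h2
      gcongr
      have : 5 / (q : ℝ) ≤ ℓ := by rw [div_le_iff₀ (by linarith)]; linarith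
      linarith
  refine (Finset.sum_le_sum h1).trans ?_
  rw [Finset.sum_add_distrib]
  refine add_le_add ?_ ?_
  · rw [Finset.sum_const, nsmul_eq_mul, Nat.card_Ico]
    refine mul_le_mul_of_nonneg_right ?_ (by positivity)
    have := Nat.ceil_lt_add_one hN
    rcases Nat.eq_zero_or_pos ⌈κ * N⌉₊ with h0 | h0
    · rw [h0]; simpa using hN
    · rw [Nat.cast_sub (by omega)]; push_cast; linarith
  · rw [← Finset.sum_filter, Finset.sum_const, nsmul_eq_mul]
    refine mul_le_mul_of_nonneg_right ?_ (by positivity)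
    have : (Finset.filter (fun q => q ∈ Finset.range ⌈5 / ℓ⌉₊)
        (Finset.Ico 1 ⌈κ * N⌉₊)).card ≤ (Finset.range ⌈5 / ℓ⌉₊).card :=
      Finset.card_le_card fun q hq => (Finset.mem_filter.1 hq).2
    rw [Finset.card_range] at this
    exact_mod_cast this

/-- Every cube contains a positive proportion of well separated rational points. -/
lemma exists_separated_rationals {m : ℕ} {a : Fin m → ℝ} (ha : ∀ k, 0 ≤ a k)
    (hsum : ∑ k, a k = 1) : ∃ κ : ℝ, 0 < κ ∧ ∃ c : ℝ, 0 < c ∧ ∀ (y : Fin m → ℝ) (ℓ : ℝ), 0 < ℓ →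
      ∃ N₀ : ℕ, ∀ N : ℕ, N₀ ≤ N → ∃ S : Finset (Fin m → ℝ),
        (∀ z ∈ S, ∃ q : ℕ, ∃ p : Fin m → ℤ, κ * N ≤ q ∧ q ≤ N ∧ 1 ≤ q ∧ ∀ k, z k = p k / q) ∧
        (∀ z ∈ S, ∀ k, |z k - y k| + (N : ℝ) ^ (-(1 + a k)) < ℓ) ∧
        (∀ z ∈ S, ∀ z' ∈ S, z ≠ z' → ∃ k, 2 * (N : ℝ) ^ (-(1 + a k)) < |z k - z' k|) ∧
        c * ℓ ^ m * (N : ℝ) ^ (m + 1 : ℝ) ≤ S.card := by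
  classical
  set κ : ℝ := 1 / (4 * 8 ^ m) with hκ
  have hκ0 : 0 < κ := by positivity
  set c : ℝ := 1 / (2 * (2 * (2 / κ + 2)) ^ m) with hc
  have hc0 : 0 < c := by positivity
  refine ⟨κ, hκ0, c, hc0, fun y ℓ hℓ => ?_⟩
  obtain ⟨N₀, hN₀⟩ := exists_nat_ge (max 1 (max (4 * 4 ^ m * (⌈5 / ℓ⌉₊ * (ℓ + 5) ^ m) / ℓ ^ m)
    ((2 / κ + 2) * (2 / ℓ))))
  refine ⟨N₀, fun N hN => ?_⟩
  have hNN : (N₀ : ℝ) ≤ N := by exact_mod_cast hN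
  have hN1 : (1 : ℝ) ≤ N := ((le_max_left _ _).trans hN₀).trans hNN
  have hN2 := (((le_max_left _ _).trans (le_max_right _ _)).trans hN₀).trans hNN
  have hN3 := (((le_max_right _ _).trans (le_max_right _ _)).trans hN₀).trans hNN
  have hN0 : (0 : ℝ) < N := by linarith
  set P : ℕ → Finset (Fin m → ℤ) := fun q => Fintype.piFinset fun k =>
    Finset.Icc ⌈q * (y k - ℓ / 2) - 2⌉ ⌊q * (y k + ℓ / 2) + 2⌋ with hP
  set M : ℕ := ⌈κ * N⌉₊ with hM
  have hPmem : ∀ q p, p ∈ P q ↔ ∀ k, (q : ℝ) * (y k - ℓ / 2) - 2 ≤ p k ∧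
      (p k : ℝ) ≤ q * (y k + ℓ / 2) + 2 := by
    intro q p
    simp only [hP, Fintype.mem_piFinset, Finset.mem_Icc, Int.ceil_le, Int.le_floor]
  set T : Finset (Fin m → ℝ) := (Finset.Ico M (N + 1)).biUnion fun q =>
    (P q).image fun p k => (p k : ℝ) / q with hT
  set e : Fin m → ℝ := fun k => (N : ℝ) ^ (-(1 + a k)) with he
  have he0 : ∀ k, 0 < e k := fun k => Real.rpow_pos_of_pos hN0 _
  obtain ⟨S, hST, hsep, hmax⟩ := T.exists_maximal_separated
    (fun z z' => ∀ k, |z k - z' k| ≤ 2 * e k)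
    (fun z k => by simpa using (he0 k).le)
    (fun z z' h k => by rw [abs_sub_comm]; exact h k)
  have hM0 : 1 ≤ M := Nat.one_le_iff_ne_zero.2 (Nat.ceil_pos.2 (by positivity)).ne'
  have hMκ : κ * N ≤ M := Nat.le_ceil _
  have hna : ∀ k, (N : ℝ) ^ (-a k) ≤ 1 := fun k =>
    Real.rpow_le_one_of_one_le_of_nonpos hN1 (by linarith [ha k])
  have hea : ∀ k, e k = (N : ℝ) ^ (-a k) / N := fun k => by
    simp only [he]
    rw [show -(1 + a k) = -a k - 1 by ring, Real.rpow_sub hN0, Real.rpow_one]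
  have hmemT : ∀ z ∈ T, ∃ q : ℕ, ∃ p ∈ P q, M ≤ q ∧ q ≤ N ∧ ∀ k, z k = p k / q := by
    intro z hz
    simp only [hT, Finset.mem_biUnion, Finset.mem_Ico, Finset.mem_image] at hz
    obtain ⟨q, ⟨h1, h2⟩, p, hp, rfl⟩ := hz
    exact ⟨q, p, hp, h1, by omega, fun k => rfl⟩
  refine ⟨S, fun z hz => ?_, fun z hz k => ?_, fun z hz z' hz' hne => ?_, ?_⟩
  · obtain ⟨q, p, -, h1, h2, h3⟩ := hmemT z (hST hz)
    exact ⟨q, p, hMκ.trans (Nat.cast_le.2 h1), h2, hM0.trans h1, h3⟩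
  · obtain ⟨q, p, hp, h1, h2, h3⟩ := hmemT z (hST hz)
    have hqM : (M : ℝ) ≤ q := by exact_mod_cast h1
    have hq0 : (0 : ℝ) < q := by linarith [mul_pos hκ0 hN0]
    have hp' := (hPmem q p).1 hp k
    have h4 : |z k - y k| ≤ ℓ / 2 + 2 / q := by
      rw [h3, abs_le]
      have h5 : (p k : ℝ) / q = p k / q := rfl
      constructor
      · rw [← sub_nonneg]
        have : (p k : ℝ) / q - y k - -(ℓ / 2 + 2 / q) =
          (p k - (q * (y k - ℓ / 2) - 2)) / q := by field_simp; ring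
        rw [this]
        exact div_nonneg (by linarith) hq0.le
      · rw [← sub_nonneg]
        have : ℓ / 2 + 2 / q - ((p k : ℝ) / q - y k) =
          ((q * (y k + ℓ / 2) + 2) - p k) / q := by field_simp; ring
        rw [this]
        exact div_nonneg (by linarith) hq0.le
    have h6 : (2 : ℝ) / q ≤ 2 / κ / N := by
      rw [div_div]
      exact div_le_div_of_nonneg_left (by norm_num) (by positivity) (hMκ.trans hqM)
    have h7 : e k ≤ 1 / N := by
      rw [hea]; gcongr; exact hna k
    have h8 : (2 / κ + 2) / N ≤ ℓ / 2 := by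
      rw [div_le_iff₀ hN0]
      have h9 : (2 / κ + 2) * (2 / ℓ) * (ℓ / 2) ≤ N * (ℓ / 2) := by gcongr
      have : (2 / κ + 2) * (2 / ℓ) * (ℓ / 2) = 2 / κ + 2 := by field_simp
      linarith
    have h10 : (2 / κ + 2) / N = 2 / κ / N + 2 / N := by ring
    have h11 : (2 : ℝ) / N = 1 / N + 1 / N := by ring
    have h12 : 0 < 1 / (N : ℝ) := by positivity
    have : e k = (N : ℝ) ^ (-(1 + a k)) := rfl
    linarith
  · have := hsep z hz z' hz' hne
    push Not at this
    exact this
  · let I : Finset ((Σ _ : ℕ, Fin m → ℤ) ⊕ (Fin m → ℝ)) :=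
      ((Finset.Ico 1 M).sigma P).disjSum S
    have hcov := pow_le_sum_prod_of_subset (y := y) (r := ℓ / 2) (by positivity) I
      (Sum.elim (fun x k => (x.2 k : ℝ) / x.1) id)
      (Sum.elim (fun x k => 2 * (N : ℝ) ^ (-a k) / x.1) (fun _ k => (2 / κ + 2) * e k)) ?_ ?_
    · have hsplit : ∑ i ∈ I, ∏ k, (2 * (Sum.elim (fun x k => 2 * (N : ℝ) ^ (-a k) / x.1)
          (fun _ k => (2 / κ + 2) * e k) i : Fin m → ℝ) k) =
          (∑ q ∈ Finset.Ico 1 M, ∑ p ∈ P q, ∏ k, (2 * (2 * (N : ℝ) ^ (-a k) / q))) +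
          S.card * ∏ k, (2 * ((2 / κ + 2) * e k)) := by
        simp only [I, Finset.sum_disjSum, Sum.elim_inl, Sum.elim_inr, Finset.sum_const,
          nsmul_eq_mul, Finset.sum_sigma]
      rw [hsplit] at hcov
      have hprod1 : ∏ k, (N : ℝ) ^ (-a k) = 1 / N := by
        rw [← Real.rpow_sum_of_pos hN0, Finset.sum_neg_distrib, hsum, Real.rpow_neg hN0.le,
          Real.rpow_one, one_div]
      have hprod2 : ∏ k, e k = (N : ℝ) ^ (-(m + 1 : ℝ)) := by
        simp only [he]
        rw [← Real.rpow_sum_of_pos hN0, Finset.sum_neg_distrib, Finset.sum_add_distrib, hsum]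
        simp
      have hS : ∏ k, (2 * ((2 / κ + 2) * e k)) =
          (2 * (2 / κ + 2)) ^ m * (N : ℝ) ^ (-(m + 1 : ℝ)) := by
        rw [← hprod2]
        simp only [← mul_assoc]
        rw [Finset.prod_mul_distrib]; simp
      have hbad : ∑ q ∈ Finset.Ico 1 M, ∑ p ∈ P q, ∏ k, (2 * (2 * (N : ℝ) ^ (-a k) / q)) ≤
          ℓ ^ m / 2 := by
        have h1 : ∀ q ∈ Finset.Ico 1 M, ∑ p ∈ P q, ∏ k, (2 * (2 * (N : ℝ) ^ (-a k) / q)) ≤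
            4 ^ m / N * (ℓ + 5 / q) ^ m := by
          intro q hq
          have hq1 : (1 : ℝ) ≤ q := by exact_mod_cast (Finset.mem_Ico.1 hq).1
          have hq0 : (0 : ℝ) < q := by linarith
          have h2 : ∏ k, (2 * (2 * (N : ℝ) ^ (-a k) / q)) = (4 / q) ^ m * (1 / N) := by
            rw [← hprod1, Finset.prod_congr rfl
              (fun k _ => show 2 * (2 * (N : ℝ) ^ (-a k) / q) = 4 / q * (N : ℝ) ^ (-a k) by ring),
              Finset.prod_mul_distrib]
            simp [div_pow]
          have h3 : ((P q).card : ℝ) ≤ (q * ℓ + 5) ^ m := by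
            simp only [hP, Fintype.card_piFinset, Nat.cast_prod]
            calc _ ≤ ∏ _k : Fin m, ((q : ℝ) * ℓ + 5) := by
                  refine Finset.prod_le_prod (fun k _ => Nat.cast_nonneg _) fun k _ => ?_
                  refine (card_Icc_ceil_floor_le ?_).trans ?_ <;> nlinarith
              _ = _ := by simp
          rw [Finset.sum_const, nsmul_eq_mul, h2]
          calc ((P q).card : ℝ) * ((4 / q) ^ m * (1 / N)) ≤
                (q * ℓ + 5) ^ m * ((4 / q) ^ m * (1 / N)) := by gcongr
            _ = 4 ^ m / N * (ℓ + 5 / q) ^ m := by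
                have : ℓ + 5 / (q : ℝ) = (q * ℓ + 5) / q := by field_simp
                rw [this, div_pow, div_pow]; ring
        refine (Finset.sum_le_sum h1).trans ?_
        rw [← Finset.mul_sum]
        have h2 := sum_add_div_pow_le m hℓ (mul_pos hκ0 hN0).le
        have h3 : 4 ^ m / (N : ℝ) * (κ * N * (2 * ℓ) ^ m) = ℓ ^ m / 4 := by
          rw [hκ, mul_pow, show (8 : ℝ) = 4 * 2 by norm_num, mul_pow]
          field_simp
        have h4 : 4 ^ m / (N : ℝ) * (⌈5 / ℓ⌉₊ * (ℓ + 5) ^ m) ≤ ℓ ^ m / 4 := by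
          rw [div_le_iff₀ (by positivity)] at hN2
          rw [div_mul_eq_mul_div, div_le_iff₀ hN0]
          linarith
        calc _ ≤ 4 ^ m / (N : ℝ) * (κ * N * (2 * ℓ) ^ m + ⌈5 / ℓ⌉₊ * (ℓ + 5) ^ m) := by gcongr
          _ ≤ _ := by rw [mul_add]; linarith
      rw [hS, mul_div_cancel₀ _ (two_ne_zero)] at hcov
      have h5 : ℓ ^ m / 2 ≤
          S.card * ((2 * (2 / κ + 2)) ^ m * (N : ℝ) ^ (-(m + 1 : ℝ))) := by linarith
      rw [Real.rpow_neg hN0.le] at h5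
      have hpos : 0 < (N : ℝ) ^ (m + 1 : ℝ) := Real.rpow_pos_of_pos hN0 _
      have hC : 0 < (2 * (2 / κ + 2)) ^ m := by positivity
      rw [hc, ← mul_assoc, ← div_eq_mul_inv, le_div_iff₀ hpos] at *
      rw [div_mul_eq_mul_div, one_mul, div_mul_eq_mul_div, div_le_iff₀ (by positivity)]
      linarith
    · intro i hi k
      rcases i with x | z
      · simp only [Sum.elim_inl]; positivity
      · simp only [Sum.elim_inr]
        have := (he0 k).le
        positivity
    · intro x hx
      have hx' : ∀ k, |x k - y k| ≤ ℓ / 2 := fun k => by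
        simpa [Real.dist_eq] using hx k (mem_univ k)
      obtain ⟨q, hq1, hqN, p, hp⟩ := exists_nat_forall_abs_mul_sub_le ha hsum
        (by exact_mod_cast hN1 : 1 ≤ N) x
      have hq0 : (0 : ℝ) < q := by exact_mod_cast hq1
      have hpP : p ∈ P q := by
        rw [hPmem]
        intro k
        have h1 := abs_le.1 (hp k)
        have h2 := abs_le.1 (hx' k)
        have h3 := hna k
        constructor <;> nlinarith
      have hxp : ∀ k, |x k - p k / q| ≤ 2 * (N : ℝ) ^ (-a k) / q := fun k => by
        rw [le_div_iff₀ hq0, ← abs_of_pos hq0, ← abs_mul, abs_of_pos hq0, sub_mul,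
          div_mul_cancel₀ _ hq0.ne', mul_comm]
        exact hp k
      rw [mem_iUnion₂]
      rcases lt_or_ge q M with hqM | hqM
      · refine ⟨Sum.inl ⟨q, p⟩, ?_, fun k _ => ?_⟩
        · simp only [I, Finset.inl_mem_disjSum, Finset.mem_sigma, Finset.mem_Ico]
          exact ⟨⟨hq1, hqM⟩, hpP⟩
        · simpa [Real.dist_eq] using hxp k
      · have hzT : (fun k => (p k : ℝ) / q) ∈ T := by
          simp only [hT, Finset.mem_biUnion, Finset.mem_Ico, Finset.mem_image]
          exact ⟨q, ⟨hqM, by omega⟩, p, hpP, rfl⟩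
        obtain ⟨z, hz, hzp⟩ := hmax _ hzT
        refine ⟨Sum.inr z, ?_, fun k _ => ?_⟩
        · simpa only [I, Finset.inr_mem_disjSum] using hz
        · simp only [Sum.elim_inr, id, Metric.mem_closedBall, Real.dist_eq]
          have h1 : 2 * (N : ℝ) ^ (-a k) / q ≤ 2 / κ * e k := by
            rw [hea, div_mul_div_comm]
            have : κ * N ≤ q := hMκ.trans (by exact_mod_cast hqM)
            gcongr
          have h2 := hzp k
          have h3 := abs_sub_le (x k) (p k / q) (z k)
          linarith [hxp k]

/-- A mass distribution principle for a decreasing sequence of compact sets. -/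
lemma hausdorffMeasure_iInter_ne_zero {m : ℕ} {s : ℝ} (hs : 0 < s) {K : ℕ → Set (Fin m → ℝ)}
    (hanti : Antitone K) (hcomp : ∀ n, IsCompact (K n)) (μ : ℕ → Measure (Fin m → ℝ))
    (hsupp : ∀ n, μ n (K n)ᶜ = 0) {B : ℝ} (hB : 0 < B)
    (hball : ∀ n x r, 0 < r → μ n (Metric.closedBall x r) ≤ ENNReal.ofReal (B * r ^ s))
    (hmass : ∀ n, 1 ≤ μ n univ) : μH[s] (⋂ n, K n) ≠ 0 := by
  intro h0
  obtain ⟨ε, hε0, hε⟩ : ∃ ε : ENNReal, 0 < ε ∧ ENNReal.ofReal B * (ε + ε) < 1 := by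
    refine ⟨ENNReal.ofReal (1 / (4 * B)), by simpa using hB, ?_⟩
    rw [← ENNReal.ofReal_add (by positivity) (by positivity), ← ENNReal.ofReal_mul hB.le,
      ← ENNReal.ofReal_one, ENNReal.ofReal_lt_ofReal_iff one_pos]
    field_simp
    norm_num
  rw [Measure.hausdorffMeasure_apply] at h0
  have h1 := (iSup₂_le_iff.1 h0.le) 1 one_pos
  have h2 : _ < ε := lt_of_le_of_lt h1 hε0
  simp only [iInf_lt_iff] at h2
  obtain ⟨t, hcov, hdiam, hsum⟩ := h2
  obtain ⟨δ, hδ0, hδ⟩ := ENNReal.exists_pos_sum_of_countable' hε0.ne' ℕ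
  have hV : ∀ j, ∃ V : Set (Fin m → ℝ), IsOpen V ∧ t j ⊆ V ∧ ∀ n, μ n V ≤
      ENNReal.ofReal B * ((⨆ _ : (t j).Nonempty, Metric.ediam (t j) ^ s) + δ j) := by
    intro j
    rcases (t j).eq_empty_or_nonempty with he | hne
    · exact ⟨∅, isOpen_empty, he.subset, by simp⟩
    have hfin : Metric.ediam (t j) ≠ ⊤ := ((hdiam j).trans_lt ENNReal.one_lt_top).ne
    set d := (Metric.ediam (t j)).toReal with hd
    have hd0 : 0 ≤ d := ENNReal.toReal_nonneg
    have hed : Metric.ediam (t j) = ENNReal.ofReal d := (ENNReal.ofReal_toReal hfin).symm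
    obtain ⟨x, hx⟩ := hne
    have hρ : ∃ ρ, d < ρ ∧ ENNReal.ofReal (ρ ^ s) < ENNReal.ofReal (d ^ s) + δ j := by
      have hcont : ContinuousAt (fun ρ : ℝ => ENNReal.ofReal (ρ ^ s)) d :=
        ENNReal.continuous_ofReal.continuousAt.comp
          (Real.continuousAt_rpow_const d s (Or.inr hs.le))
      have hev := hcont.eventually_lt_const
        (show ENNReal.ofReal (d ^ s) < ENNReal.ofReal (d ^ s) + δ j from
          ENNReal.lt_add_right ENNReal.ofReal_ne_top (hδ0 j).ne')
      obtain ⟨η, hη, hball'⟩ := Metric.eventually_nhds_iff.1 hev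
      refine ⟨d + η / 2, by linarith, hball' ?_⟩
      rw [Real.dist_eq, add_sub_cancel_left, abs_of_pos (by linarith)]
      linarith
    obtain ⟨ρ, hdρ, hρ⟩ := hρ
    refine ⟨Metric.ball x ρ, Metric.isOpen_ball, fun y hy => ?_, fun n => ?_⟩
    · rw [Metric.mem_ball]
      have := Metric.edist_le_ediam_of_mem hy hx
      rw [hed, edist_dist, ENNReal.ofReal_le_ofReal_iff hd0] at this
      linarith
    · refine (measure_mono Metric.ball_subset_closedBall).trans
        ((hball n x ρ (by linarith)).trans ?_)
      rw [ENNReal.ofReal_mul hB.le, iSup_pos ⟨x, hx⟩, hed, ENNReal.ofReal_rpow_of_nonneg hd0 hs.le]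
      gcongr
  choose V hVo hVt hVμ using hV
  obtain ⟨n, hn⟩ : ∃ n, K n ⊆ ⋃ j, V j := by
    refine exists_subset_nhds_of_isCompact hanti.directed_ge hcomp fun x hx => ?_
    refine (isOpen_iUnion hVo).mem_nhds ?_
    obtain ⟨j, hj⟩ := mem_iUnion.1 (hcov hx)
    exact mem_iUnion.2 ⟨j, hVt j hj⟩
  have : (1 : ENNReal) < 1 := by
    calc (1 : ENNReal) ≤ μ n univ := hmass n
      _ = μ n (K n ∪ (K n)ᶜ) := by rw [union_compl_self]
      _ ≤ μ n (K n) + μ n (K n)ᶜ := measure_union_le _ _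
      _ = μ n (K n) := by rw [hsupp, add_zero]
      _ ≤ μ n (⋃ j, V j) := measure_mono hn
      _ ≤ ∑' j, μ n (V j) := measure_iUnion_le _
      _ ≤ ∑' j, ENNReal.ofReal B *
            ((⨆ _ : (t j).Nonempty, Metric.ediam (t j) ^ s) + δ j) :=
          ENNReal.tsum_le_tsum fun j => hVμ j n
      _ = ENNReal.ofReal B *
            ((∑' j, ⨆ _ : (t j).Nonempty, Metric.ediam (t j) ^ s) + ∑' j, δ j) := by
          rw [ENNReal.tsum_mul_left, ENNReal.tsum_add]
      _ ≤ ENNReal.ofReal B * (ε + ε) := by gcongr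
      _ < 1 := hε
  exact lt_irrefl _ this

lemma hausdorffMeasure_approxSet_eq_zero {m : ℕ} {τ : Fin m → ℝ} (hpos : ∀ i, 0 < τ i)
    (i : Fin m) {s : ℝ} (hs0 : 0 < s)
    (hs : m + 1 + ∑ k, max (τ i - τ k) 0 < s * (1 + τ i)) :
    μH[s] (approxSet m (psiTau m τ)) = 0 := by
  classical
  set ε : ℕ → ℝ := fun q => (q : ℝ) ^ (-(1 + τ i)) with hε
  set J : ℕ → Fin m → ℕ := fun q k => ⌈(q : ℝ) ^ max (τ i - τ k) 0⌉₊ with hJ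
  let F : ℕ → Finset (Fin m → ℤ × ℤ) := fun q => Fintype.piFinset fun k =>
    Finset.Icc (-1) ((q : ℤ) + 1) ×ˢ Finset.Icc (-(J q k : ℤ)) (J q k)
  let t : ∀ n : ℕ, (Σ j : ℕ, {u // u ∈ F (j + n)}) → Set (Fin m → ℝ) := fun n x =>
    Metric.closedBall (fun k => ((x.2.1 k).1 : ℝ) / ((x.1 + n : ℕ) : ℝ) +
      (x.2.1 k).2 * ε (x.1 + n)) (ε (x.1 + n))
  have hdiam : ∀ n x, Metric.ediam (t n x) ≤ ENNReal.ofReal (2 * ε (x.1 + n)) := fun n x => by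
    simp only [t]
    rw [← Metric.closedEBall_ofReal (by simp only [hε]; positivity), ENNReal.ofReal_mul zero_le_two,
      ENNReal.ofReal_ofNat]
    exact Metric.ediam_closedEBall_le
  set f : ℕ → ℝ := fun q => 20 ^ m * 2 ^ s *
    (q : ℝ) ^ (m + ∑ k, max (τ i - τ k) 0 - s * (1 + τ i)) with hf
  have hfs : Summable f := (Real.summable_nat_rpow.2 (by linarith)).mul_left _
  have hcard : ∀ q : ℕ, 1 ≤ q →
      ((F q).card : ℝ) ≤ 20 ^ m * (q : ℝ) ^ (m + ∑ k, max (τ i - τ k) 0) := by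
    intro q hq
    have hq1 : (1 : ℝ) ≤ q := by exact_mod_cast hq
    have hq0 : (0 : ℝ) < q := by linarith
    have h1 : 20 ^ m * (q : ℝ) ^ (m + ∑ k, max (τ i - τ k) 0) =
        ∏ k, (20 * (q * (q : ℝ) ^ max (τ i - τ k) 0)) := by
      rw [Finset.prod_mul_distrib, Finset.prod_mul_distrib, ← Real.rpow_sum_of_pos hq0,
        Real.rpow_add hq0]
      simp
    rw [h1, Fintype.card_piFinset, Nat.cast_prod]
    refine Finset.prod_le_prod (fun k _ => Nat.cast_nonneg _) fun k _ => ?_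
    rw [Finset.card_product, Int.card_Icc, Int.card_Icc, Nat.cast_mul]
    have h2 : ((q : ℤ) + 1 + 1 - -1).toNat = q + 3 := by omega
    have h3 : ((J q k : ℤ) + 1 - -(J q k : ℤ)).toNat = 2 * J q k + 1 := by omega
    rw [h2, h3]
    push_cast
    have hy : 1 ≤ (q : ℝ) ^ max (τ i - τ k) 0 := Real.one_le_rpow hq1 (le_max_right _ _)
    have h4 : (J q k : ℝ) < (q : ℝ) ^ max (τ i - τ k) 0 + 1 :=
      Nat.ceil_lt_add_one (by linarith)
    calc ((q : ℝ) + 3) * (2 * J q k + 1) ≤ (4 * q) * (5 * (q : ℝ) ^ max (τ i - τ k) 0) := by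
          gcongr <;> linarith
      _ = _ := by ring
  have hsum : ∀ n : ℕ, 1 ≤ n →
      ∑' x, Metric.ediam (t n x) ^ s ≤ ∑' j, ENNReal.ofReal (f (j + n)) := by
    intro n hn
    rw [ENNReal.tsum_sigma']
    refine ENNReal.tsum_le_tsum fun j => ?_
    have hq1 : (1 : ℝ) ≤ ((j + n : ℕ) : ℝ) := by exact_mod_cast (by omega : 1 ≤ j + n)
    have hq0 : (0 : ℝ) < ((j + n : ℕ) : ℝ) := by linarith
    have hε0 : 0 ≤ 2 * ε (j + n) := by simp only [hε]; positivity
    calc ∑' u : {u // u ∈ F (j + n)}, Metric.ediam (t n ⟨j, u⟩) ^ s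
        ≤ ∑' u : {u // u ∈ F (j + n)}, ENNReal.ofReal ((2 * ε (j + n)) ^ s) := by
          refine ENNReal.tsum_le_tsum fun u => ?_
          rw [← ENNReal.ofReal_rpow_of_nonneg hε0 hs0.le]
          exact ENNReal.rpow_le_rpow (hdiam n ⟨j, u⟩) hs0.le
      _ = ENNReal.ofReal ((F (j + n)).card * (2 * ε (j + n)) ^ s) := by
          rw [tsum_fintype, Finset.sum_const, Finset.card_univ, Fintype.card_coe, nsmul_eq_mul,
            ENNReal.ofReal_mul (Nat.cast_nonneg _), ENNReal.ofReal_natCast]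
      _ ≤ ENNReal.ofReal (f (j + n)) := by
          refine ENNReal.ofReal_le_ofReal ?_
          calc ((F (j + n)).card : ℝ) * (2 * ε (j + n)) ^ s ≤
              (20 ^ m * ((j + n : ℕ) : ℝ) ^ (m + ∑ k, max (τ i - τ k) 0)) *
                (2 * ε (j + n)) ^ s := by
                gcongr
                exact hcard _ (by omega)
            _ = f (j + n) := by
                simp only [hf, hε]
                rw [Real.mul_rpow zero_le_two (by positivity), ← Real.rpow_mul hq0.le,
                  sub_eq_add_neg (_ + _) (s * _), Real.rpow_add hq0 (_ + _),
                  show -(1 + τ i) * s = -(s * (1 + τ i)) by ring]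
                ring
  have hr : Filter.Tendsto (fun n : ℕ => ENNReal.ofReal (2 * ε n)) Filter.atTop (nhds 0) := by
    rw [← ENNReal.ofReal_zero]
    refine ENNReal.tendsto_ofReal ?_
    have := ((tendsto_rpow_neg_atTop (show 0 < 1 + τ i by linarith [hpos i])).comp
      tendsto_natCast_atTop_atTop).const_mul 2
    rw [mul_zero] at this
    exact this
  have hle := Measure.hausdorffMeasure_le_liminf_tsum s (approxSet m (psiTau m τ))
    (l := Filter.atTop) (fun n : ℕ => ENNReal.ofReal (2 * ε n)) hr t ?_ ?_
  · have htail := ENNReal.tendsto_sum_nat_add (fun q => ENNReal.ofReal (f q))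
      hfs.tsum_ofReal_ne_top
    refine le_antisymm (hle.trans ?_) bot_le
    rw [← htail.liminf_eq]
    refine Filter.liminf_le_liminf ?_
    filter_upwards [Filter.eventually_ge_atTop 1] with n hn using hsum n hn
  · filter_upwards [Filter.eventually_ge_atTop 1] with n hn x
    refine (hdiam n x).trans (ENNReal.ofReal_le_ofReal ?_)
    have hn0 : (0 : ℝ) < n := by exact_mod_cast hn
    have : ε (x.1 + n) ≤ ε n :=
      Real.rpow_le_rpow_of_nonpos hn0 (by push_cast; linarith [Nat.cast_nonneg (α := ℝ) x.1])
        (by linarith [hpos i])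
    linarith
  · filter_upwards [Filter.eventually_ge_atTop 1] with n hn x hx
    obtain ⟨q, ⟨hq, p, hp⟩, hnq⟩ := hx.2.exists_gt n
    obtain ⟨j, rfl⟩ : ∃ j, q = j + n := ⟨q - n, by omega⟩
    set q := j + n with hqdef
    have hq1 : (1 : ℝ) ≤ q := by exact_mod_cast hq
    have hq0 : (0 : ℝ) < q := by linarith
    have hε0 : 0 < ε q := Real.rpow_pos_of_pos hq0 _
    have hp' : ∀ k, |(x k - p k / q) / ε q| ≤ J q k := by
      intro k
      have h1 : |x k - p k / q| ≤ (q : ℝ) ^ (-τ k) / q := by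
        rw [le_div_iff₀ hq0, ← abs_of_pos hq0, ← abs_mul, abs_of_pos hq0, sub_mul,
          div_mul_cancel₀ _ hq0.ne', mul_comm]
        exact (hp k).le
      rw [abs_div, abs_of_pos hε0, div_le_iff₀ hε0]
      refine h1.trans ?_
      calc (q : ℝ) ^ (-τ k) / q = (q : ℝ) ^ (τ i - τ k) * ε q := by
            simp only [hε]
            rw [← Real.rpow_add hq0, ← Real.rpow_sub_one hq0.ne']
            congr 1; ring
        _ ≤ (q : ℝ) ^ max (τ i - τ k) 0 * ε q := by
            gcongr
            exact le_max_left _ _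
        _ ≤ J q k * ε q := by
            gcongr
            exact Nat.le_ceil _
    have hpr : ∀ k, -1 ≤ p k ∧ p k ≤ q + 1 := by
      intro k
      have h1 := abs_lt.1 (hp k)
      have h2 : psiTau m τ q k ≤ 1 :=
        Real.rpow_le_one_of_one_le_of_nonpos hq1 (by linarith [hpos k])
      have h3 := hx.1 k
      have h4 : 0 ≤ (q : ℝ) * x k := mul_nonneg hq0.le h3.1
      have h5 : (q : ℝ) * x k ≤ q := mul_le_of_le_one_right hq0.le h3.2
      constructor
      · have : (-1 : ℝ) ≤ p k := by linarith
        exact_mod_cast this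
      · have : (p k : ℝ) ≤ q + 1 := by linarith
        exact_mod_cast this
    refine mem_iUnion.2 ⟨⟨j, ⟨fun k => (p k, ⌊(x k - p k / q) / ε q⌋), ?_⟩⟩, ?_⟩
    · simp only [F, Fintype.mem_piFinset, Finset.mem_product, Finset.mem_Icc]
      refine fun k => ⟨hpr k, ?_, ?_⟩
      · rw [Int.le_floor]
        push_cast
        exact (abs_le.1 (hp' k)).1
      · have := (Int.floor_le _).trans (abs_le.1 (hp' k)).2
        exact_mod_cast this
    · simp only [t]
      rw [Metric.mem_closedBall, dist_pi_le_iff hε0.le]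
      intro k
      rw [Real.dist_eq]
      have h1 := Int.floor_le ((x k - p k / q) / ε q)
      have h2 := (Int.lt_floor_add_one ((x k - p k / q) / ε q)).le
      rw [le_div_iff₀ hε0] at h1
      rw [div_le_iff₀ hε0] at h2
      rw [abs_le]
      constructor <;> linarith

lemma dimH_approxSet_le {m : ℕ} {τ : Fin m → ℝ} (hpos : ∀ i, 0 < τ i) (i : Fin m) :
    dimH (approxSet m (psiTau m τ)) ≤
      ENNReal.ofReal ((m + 1 + ∑ k, max (τ i - τ k) 0) / (1 + τ i)) := by
  by_contra! h
  obtain ⟨s, h1, h2⟩ := ENNReal.lt_iff_exists_nnreal_btwn.1 h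
  have hi := hpos i
  have h3 : 0 ≤ ∑ k, max (τ i - τ k) 0 := Finset.sum_nonneg fun k _ => le_max_right _ _
  have h4 : (m + 1 + ∑ k, max (τ i - τ k) 0) / (1 + τ i) < s := by
    rw [← ENNReal.ofReal_coe_nnreal] at h1
    exact lt_of_not_ge fun hge => h1.not_ge (ENNReal.ofReal_le_ofReal hge)
  have h5 : 0 < (m + 1 + ∑ k, max (τ i - τ k) 0) / (1 + τ i) := by positivity
  have h6 := hausdorffMeasure_approxSet_eq_zero hpos i (h5.trans h4)
    ((div_lt_iff₀ (by linarith)).1 h4)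
  rw [hausdorffMeasure_of_lt_dimH h2] at h6
  exact ENNReal.top_ne_zero h6

lemma card_le_prod_of_separated {m : ℕ} {ι : Type*} (I : Finset ι) (z : ι → Fin m → ℝ)
    {g R : Fin m → ℝ} (hg : ∀ k, 0 < g k) (hR : ∀ k, 0 ≤ R k)
    (hsep : ∀ i ∈ I, ∀ j ∈ I, i ≠ j → ∃ k, 2 * g k < |z i k - z j k|) (x : Fin m → ℝ)
    (hx : ∀ i ∈ I, ∀ k, |z i k - x k| ≤ R k) : (I.card : ℝ) ≤ ∏ k, ((R k + g k) / g k) := by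
  have h1 : ∀ i, volume (univ.pi fun k => Metric.closedBall (z i k) (g k)) =
      ENNReal.ofReal (∏ k, (2 * g k)) := fun i => volume_pi_closedBall_eq _ fun k => (hg k).le
  have h2 : volume (⋃ i ∈ I, univ.pi fun k => Metric.closedBall (z i k) (g k)) =
      I.card * ENNReal.ofReal (∏ k, (2 * g k)) := by
    rw [measure_biUnion_finset, Finset.sum_congr rfl fun i _ => h1 i, Finset.sum_const,
      nsmul_eq_mul]
    · intro i hi j hj hij
      obtain ⟨k, hk⟩ := hsep i hi j hj hij
      refine Set.disjoint_left.2 fun y hy hy' => ?_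
      have h3 := hy k (mem_univ _)
      have h4 := hy' k (mem_univ _)
      rw [Metric.mem_closedBall, Real.dist_eq, abs_sub_comm] at h3
      rw [Metric.mem_closedBall, Real.dist_eq] at h4
      have := abs_sub_le (z i k) (y k) (z j k)
      linarith
    · exact fun i _ => MeasurableSet.univ_pi fun k => Metric.isClosed_closedBall.measurableSet
  have h3 : volume (⋃ i ∈ I, univ.pi fun k => Metric.closedBall (z i k) (g k)) ≤
      volume (univ.pi fun k => Metric.closedBall (x k) (R k + g k)) := by
    refine measure_mono (iUnion₂_subset fun i hi => Set.pi_mono fun k _ => ?_)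
    refine Metric.closedBall_subset_closedBall' ?_
    rw [Real.dist_eq]
    linarith [hx i hi k]
  rw [h2, volume_pi_closedBall_eq _ fun k => add_nonneg (hR k) (hg k).le,
    ← ENNReal.ofReal_natCast, ← ENNReal.ofReal_mul (Nat.cast_nonneg _),
    ENNReal.ofReal_le_ofReal_iff (Finset.prod_nonneg fun k _ => by linarith [hR k, hg k])] at h3
  have h4 : 0 < ∏ k, (2 * g k) := Finset.prod_pos fun k _ => by linarith [hg k]
  rw [← le_div_iff₀ h4, ← Finset.prod_div_distrib] at h3
  refine h3.trans_eq (Finset.prod_congr rfl fun k _ => ?_)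
  rw [mul_div_mul_left _ _ two_ne_zero]

lemma volume_pi_ball_inter_closedBall_le {m : ℕ} (z x : Fin m → ℝ) {h : Fin m → ℝ}
    (hh : ∀ k, 0 < h k) {r : ℝ} (hr : 0 < r) :
    volume ((univ.pi fun k => Metric.ball (z k) (h k)) ∩ Metric.closedBall x r) ≤
      ENNReal.ofReal (∏ k, (2 * h k)) * ENNReal.ofReal (∏ k, min 1 (r / h k)) := by
  have h1 : (univ.pi fun k => Metric.ball (z k) (h k)) ∩ Metric.closedBall x r =
      univ.pi fun k => Metric.ball (z k) (h k) ∩ Metric.closedBall (x k) r := by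
    rw [closedBall_pi _ hr.le, Set.pi_inter_distrib]
  rw [h1, volume_pi_pi,
    ← ENNReal.ofReal_mul (Finset.prod_nonneg fun k _ => by linarith [hh k]),
    ← Finset.prod_mul_distrib, ENNReal.ofReal_prod_of_nonneg fun k _ => by
      have := hh k; positivity]
  refine Finset.prod_le_prod' fun k _ => ?_
  rcases le_total 1 (r / h k) with h2 | h2
  · rw [min_eq_left h2, mul_one, ← Real.volume_ball (z k)]
    exact measure_mono inter_subset_left
  · rw [min_eq_right h2, mul_assoc, mul_div_cancel₀ _ (hh k).ne', ← Real.volume_closedBall (x k)]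
    exact measure_mono inter_subset_right

lemma sum_volume_inter_closedBall_le {m : ℕ} {ι : Type*} (I : Finset ι) (z : ι → Fin m → ℝ)
    {g h : Fin m → ℝ} (hh : ∀ k, 0 < h k) (hgh : ∀ k, h k ≤ g k)
    (hsep : ∀ i ∈ I, ∀ j ∈ I, i ≠ j → ∃ k, 2 * g k < |z i k - z j k|) (x : Fin m → ℝ)
    {r : ℝ} (hr : 0 < r) :
    ∑ i ∈ I, (ENNReal.ofReal (∏ k, (2 * h k)))⁻¹ *
        volume ((univ.pi fun k => Metric.ball (z i k) (h k)) ∩ Metric.closedBall x r) ≤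
      ENNReal.ofReal (3 ^ m * ∏ k, (max (r / g k) 1 * min 1 (r / h k))) := by
  classical
  have hg : ∀ k, 0 < g k := fun k => (hh k).trans_le (hgh k)
  set I' := I.filter fun i => ∀ k, |z i k - x k| ≤ r + h k with hI'
  have hV : 0 < ∏ k, (2 * h k) := Finset.prod_pos fun k _ => by linarith [hh k]
  have hcard : (I'.card : ℝ) ≤ ∏ k, (3 * max (r / g k) 1) := by
    refine (card_le_prod_of_separated I' z hg (R := fun k => r + h k)
      (fun k => by linarith [hh k]) ?_ x ?_).trans ?_
    · exact fun i hi j hj => hsep i (Finset.mem_filter.1 hi).1 j (Finset.mem_filter.1 hj).1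
    · exact fun i hi => (Finset.mem_filter.1 hi).2
    · refine Finset.prod_le_prod (fun k _ => ?_) fun k _ => ?_
      · have := hh k; have := hg k; positivity
      · rw [add_div, add_div, div_self (hg k).ne']
        have h1 : h k / g k ≤ 1 := (div_le_one (hg k)).2 (hgh k)
        linarith [le_max_left (r / g k) 1, le_max_right (r / g k) 1]
  rw [← Finset.sum_subset (Finset.filter_subset _ I : I' ⊆ I)]
  · calc _ ≤ ∑ i ∈ I', ENNReal.ofReal (∏ k, min 1 (r / h k)) := by
          refine Finset.sum_le_sum fun i _ => ?_
          refine (mul_le_mul_right (volume_pi_ball_inter_closedBall_le (z i) x hh hr) _).trans_eq ?_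
          rw [← mul_assoc, ENNReal.inv_mul_cancel (by simpa using hV) ENNReal.ofReal_ne_top, one_mul]
      _ = ENNReal.ofReal (I'.card * ∏ k, min 1 (r / h k)) := by
          rw [Finset.sum_const, nsmul_eq_mul, ENNReal.ofReal_mul (Nat.cast_nonneg _),
            ENNReal.ofReal_natCast]
      _ ≤ _ := by
          refine ENNReal.ofReal_le_ofReal ?_
          rw [Finset.prod_mul_distrib, ← mul_assoc]
          refine mul_le_mul_of_nonneg_right ?_ (Finset.prod_nonneg fun k _ => ?_)
          · rw [Finset.prod_mul_distrib] at hcard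
            simpa using hcard
          · have := hh k; positivity
  · intro i hi hi'
    have h1 : (univ.pi fun k => Metric.ball (z i k) (h k)) ∩ Metric.closedBall x r = ∅ := by
      refine Set.eq_empty_of_forall_notMem fun y hy => hi' ?_
      refine Finset.mem_filter.2 ⟨hi, fun k => ?_⟩
      have h2 := hy.1 k (mem_univ _)
      have h3 := (dist_pi_le_iff hr.le).1 (Metric.mem_closedBall.1 hy.2) k
      rw [Metric.mem_ball, Real.dist_eq, abs_sub_comm] at h2
      rw [Real.dist_eq] at h3
      have := abs_sub_le (z i k) (y k) (x k)
      linarith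
    rw [h1, measure_empty, mul_zero]

/-- The centre of the grid cell of side `1 / n` with index `ν`. -/
def gridCenter {m : ℕ} (n : ℕ) (ν : Fin m → ℤ) : Fin m → ℝ := fun k => ((ν k : ℝ) + 1 / 2) / n

/-- The grid cell of side `1 / n` with index `ν`. -/
def gridCell {m : ℕ} (n : ℕ) (ν : Fin m → ℤ) : Set (Fin m → ℝ) :=
  {x | (fun k => ⌊n * x k⌋) = ν}

lemma gridCell_subset {m n : ℕ} (hn : 1 ≤ n) (ν : Fin m → ℤ) :
    gridCell n ν ⊆ Metric.closedBall (gridCenter n ν) (1 / (2 * n)) := by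
  rintro x rfl
  have hn0 : (0 : ℝ) < n := by exact_mod_cast hn
  rw [Metric.mem_closedBall, dist_pi_le_iff (by positivity)]
  intro k
  have h1 := Int.floor_le (n * x k)
  have h2 := (Int.lt_floor_add_one (n * x k)).le
  have h3 : x k - ((⌊n * x k⌋ : ℝ) + 1 / 2) / n = (n * x k - (⌊n * x k⌋ + 1 / 2)) / n := by
    field_simp
  have h4 : 1 / (2 * (n : ℝ)) = (1 / 2) / n := by field_simp
  rw [Real.dist_eq, gridCenter, h3, h4, abs_div, abs_of_pos hn0]
  gcongr
  rw [abs_le]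
  constructor <;> linarith

lemma measurableSet_gridCell {m n : ℕ} (ν : Fin m → ℤ) : MeasurableSet (gridCell n ν) := by
  have : Measurable fun x : Fin m → ℝ => fun k => ⌊n * x k⌋ := by fun_prop
  exact this (measurableSet_singleton ν)

lemma pairwise_disjoint_gridCell (m n : ℕ) :
    Pairwise (Function.onFun Disjoint (gridCell (m := m) n)) := by
  intro ν ν' h
  refine Set.disjoint_left.2 fun x hx hx' => h ?_
  rw [← show _ = ν from hx, ← show _ = ν' from hx']

lemma volume_gridCell_le {m n : ℕ} (hn : 1 ≤ n) (ν : Fin m → ℤ) :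
    volume (gridCell n ν) ≤ ENNReal.ofReal ((2 * (1 / (2 * n))) ^ m) := by
  refine (measure_mono (gridCell_subset hn ν)).trans_eq ?_
  rw [closedBall_pi _ (by positivity), volume_pi_closedBall_eq _ fun k => by positivity]
  simp

lemma exists_gridCell_subset {m : ℕ} {μ : Measure (Fin m → ℝ)} [IsFiniteMeasure μ]
    {U : Set (Fin m → ℝ)} (hU : IsOpen U) (hμU : μ Uᶜ = 0) {M : ENNReal} (hM : M < μ univ)
    (n₀ : ℕ) : ∃ n, n₀ ≤ n ∧ 1 ≤ n ∧ ∃ G : Finset (Fin m → ℤ),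
      (∀ ν ∈ G, Metric.closedBall (gridCenter n ν) (1 / (2 * n)) ⊆ U) ∧
      M < ∑ ν ∈ G, μ (gridCell n ν) := by
  have h1 : M < μ U := by
    rwa [← measure_add_measure_compl hU.measurableSet, hμU, add_zero] at hM
  obtain ⟨K, hKU, hK, hMK⟩ := hU.exists_lt_isCompact h1
  obtain ⟨δ, hδ, hδU⟩ := hK.exists_cthickening_subset_open hU hKU
  obtain ⟨n₁, hn₁⟩ := exists_nat_gt (1 / δ)
  refine ⟨max (max n₀ n₁) 1, by omega, by omega, ?_⟩
  set n := max (max n₀ n₁) 1 with hn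
  have hn1 : 1 ≤ n := by omega
  have hn0 : (0 : ℝ) < n := by exact_mod_cast hn1
  have hnδ : 1 / (n : ℝ) ≤ δ := by
    rw [one_div_le hn0 hδ]
    have : (n₁ : ℝ) ≤ n := by exact_mod_cast (by omega : n₁ ≤ n)
    linarith
  have hfin : ((fun x : Fin m → ℝ => fun k => ⌊n * x k⌋) '' K).Finite := by
    obtain ⟨R, hR⟩ := hK.isBounded.exists_norm_le
    refine (Set.finite_Icc (fun _ : Fin m => ⌊-(n * R)⌋) (fun _ => ⌊n * R⌋)).subset ?_
    rintro _ ⟨x, hx, rfl⟩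
    have h2 : ∀ k, |x k| ≤ R := fun k => (norm_le_pi_norm x k).trans (hR x hx)
    constructor
    · intro k
      refine Int.floor_le_floor ?_
      rw [← mul_neg]
      exact mul_le_mul_of_nonneg_left (abs_le.1 (h2 k)).1 hn0.le
    · intro k
      refine Int.floor_le_floor ?_
      exact mul_le_mul_of_nonneg_left (abs_le.1 (h2 k)).2 hn0.le
  refine ⟨hfin.toFinset, ?_, ?_⟩
  · intro ν hν
    obtain ⟨x, hx, hxν⟩ := hfin.mem_toFinset.1 hν
    intro y hy
    refine hδU (Metric.mem_cthickening_of_dist_le y x δ K hx ?_)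
    have h2 := gridCell_subset hn1 ν hxν
    rw [Metric.mem_closedBall] at hy h2
    have h3 := dist_triangle_right y x (gridCenter n ν)
    have h4 : 1 / (2 * (n : ℝ)) + 1 / (2 * n) = 1 / n := by field_simp; norm_num
    linarith
  · refine hMK.trans_le ?_
    rw [← measure_biUnion_finset (fun _ _ _ _ h => pairwise_disjoint_gridCell m n h)
      fun ν _ => measurableSet_gridCell ν]
    refine measure_mono fun x hx => ?_
    exact mem_iUnion₂.2 ⟨_, hfin.mem_toFinset.2 (mem_image_of_mem _ hx), rfl⟩

/-- `μ` is a finite measure of mass larger than one with bounded density that lives on the open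
set `U` and satisfies the Frostman condition `μ (B(x, r)) ≤ B r ^ s`. -/
structure IsFrostmanOn {m : ℕ} (s B : ℝ) (μ : Measure (Fin m → ℝ)) (U : Set (Fin m → ℝ)) :
    Prop where
  finite : IsFiniteMeasure μ
  exists_density : ∃ D : ℝ, 0 ≤ D ∧ ∀ A, μ A ≤ ENNReal.ofReal D * volume A
  isOpen : IsOpen U
  compl : μ Uᶜ = 0
  mass : 1 < μ univ
  ball : ∀ x r, 0 < r → μ (Metric.closedBall x r) ≤ ENNReal.ofReal (B * r ^ s)

lemma exists_pos_forall_mul_rpow_le {C e : ℝ} (hC : 0 ≤ C) (he : 0 < e) :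
    ∃ r₀ : ℝ, 0 < r₀ ∧ r₀ ≤ 1 ∧ ∀ r, 0 < r → r ≤ r₀ → C * r ^ e ≤ 1 := by
  have hC1 : 0 < C + 1 := by linarith
  refine ⟨((C + 1)⁻¹) ^ e⁻¹, by positivity,
    Real.rpow_le_one (by positivity) (inv_le_one_of_one_le₀ (by linarith)) (by positivity), ?_⟩
  intro r hr hr0
  have h1 : r ^ e ≤ (C + 1)⁻¹ := by
    refine (Real.rpow_le_rpow hr.le hr0 he.le).trans_eq ?_
    rw [← Real.rpow_mul (by positivity), inv_mul_cancel₀ he.ne', Real.rpow_one]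
  calc C * r ^ e ≤ (C + 1) * (C + 1)⁻¹ := by gcongr; linarith
    _ = 1 := mul_inv_cancel₀ hC1.ne'

lemma exists_nat_forall_mul_add_rpow_le {s B B' r₀ : ℝ} (hs : 0 < s) (hB : 0 < B) (hBB' : B < B')
    (hr₀ : 0 < r₀) : ∃ n₁ : ℕ, ∀ n : ℕ, n₁ ≤ n → ∀ r, r₀ ≤ r →
      B * (r + 1 / n) ^ s ≤ B' * r ^ s := by
  have h1 : Filter.Tendsto (fun n : ℕ => (1 + 1 / (n : ℝ) / r₀) ^ s) Filter.atTop (nhds 1) := by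
    have h2 := (tendsto_one_div_atTop_nhds_zero_nat (𝕜 := ℝ)).div_const r₀
    have h3 := (h2.const_add 1).rpow_const (p := s) (Or.inr hs.le)
    simpa using h3
  obtain ⟨n₁, hn₁⟩ := Filter.eventually_atTop.1
    (h1.eventually_le_const ((one_lt_div hB).2 hBB'))
  refine ⟨n₁, fun n hn r hr => ?_⟩
  have hr0 : 0 < r := hr₀.trans_le hr
  have h4 : (0 : ℝ) ≤ 1 / n := by positivity
  calc B * (r + 1 / n) ^ s ≤ B * (r * (1 + 1 / n / r₀)) ^ s := by
        have h5 : 1 / (n : ℝ) ≤ r * (1 / n / r₀) := by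
          rw [mul_div_assoc', le_div_iff₀ hr₀, mul_comm r]
          exact mul_le_mul_of_nonneg_left hr h4
        gcongr
        linarith
    _ = B * (1 + 1 / n / r₀) ^ s * r ^ s := by
        rw [Real.mul_rpow hr0.le (by positivity)]; ring
    _ ≤ B * (B' / B) * r ^ s := by gcongr; exact hn₁ n hn
    _ = B' * r ^ s := by rw [mul_div_cancel₀ _ hB.ne']

lemma le_abs_gridCenter_sub {m n : ℕ} (hn : 1 ≤ n) {ν ν' : Fin m → ℤ} (h : ν ≠ ν') :
    ∃ k, 2 * (1 / (2 * (n : ℝ))) ≤ |gridCenter n ν k - gridCenter n ν' k| := by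
  obtain ⟨k, hk⟩ := Function.ne_iff.1 h
  refine ⟨k, ?_⟩
  have hn0 : (0 : ℝ) < n := by exact_mod_cast hn
  have h1 : gridCenter n ν k - gridCenter n ν' k = ((ν k - ν' k : ℤ) : ℝ) / n := by
    simp only [gridCenter]; push_cast; ring
  have h2 : 2 * (1 / (2 * (n : ℝ))) = 1 / n := by field_simp
  rw [h1, h2, abs_div, abs_of_pos hn0]
  gcongr
  have := Int.one_le_abs (sub_ne_zero.2 hk)
  exact_mod_cast this

lemma abs_mul_sub_lt_psiTau {m : ℕ} {τ : Fin m → ℝ} {q N : ℕ} (hq : 1 ≤ q) (hqN : q ≤ N)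
    (k : Fin m) (hτ : 0 < τ k) {x : ℝ} {p : ℤ} (h : |x - p / q| < (N : ℝ) ^ (-(1 + τ k))) :
    |q * x - p| < psiTau m τ q k := by
  have hq0 : (0 : ℝ) < q := by exact_mod_cast hq
  have h1 : (q : ℝ) * x - p = q * (x - p / q) := by field_simp
  rw [h1, abs_mul, abs_of_pos hq0]
  calc q * |x - p / q| < q * (N : ℝ) ^ (-(1 + τ k)) := by gcongr
    _ ≤ q * (q : ℝ) ^ (-(1 + τ k)) := by
        refine mul_le_mul_of_nonneg_left ?_ hq0.le
        exact Real.rpow_le_rpow_of_nonpos hq0 (by exact_mod_cast hqN) (by linarith)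
    _ = psiTau m τ q k := by
        rw [psiTau, ← Real.rpow_one_add' hq0.le (by linarith)]
        congr 1; ring

lemma IsFrostmanOn.exists_next {m : ℕ} {τ : Fin m → ℝ} (hpos : ∀ i, 0 < τ i)
    (hsum : 1 < ∑ i, τ i) {s s₀ : ℝ} (hs : 0 < s) (hss : s < s₀) (hsm : s₀ ≤ m)
    (hH : ∀ i, s₀ * (1 + τ i) ≤ m + 1 + ∑ k, max (τ i - τ k) 0)
    {μ : Measure (Fin m → ℝ)} {U : Set (Fin m → ℝ)} {B B' : ℝ} (hμ : IsFrostmanOn s B μ U)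
    (hB : 1 ≤ B) (hBB' : B < B') (n₀ : ℕ) :
    ∃ μ' U', IsFrostmanOn s B' μ' U' ∧ closure U' ⊆ U ∧ ∀ x ∈ U', ∃ q : ℕ, n₀ ≤ q ∧ 0 < q ∧
      ∃ p : Fin m → ℤ, ∀ k, |(q : ℝ) * x k - p k| < psiTau m τ q k := by
  classical
  obtain ⟨α, hα0, hα⟩ := exists_sum_min_eq_one hpos hsum
  have ha : ∀ k, 0 ≤ min α (τ k) := fun k => le_min hα0.le (hpos k).le
  obtain ⟨κ, hκ, c, hc, hS⟩ := exists_separated_rationals ha hα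
  obtain ⟨D, hD0, hD⟩ := hμ.exists_density
  set C := D * 2 ^ m / c * 3 ^ m with hC
  have hC0 : 0 ≤ C := by positivity
  obtain ⟨r₀, hr₀, hr₀1, hr₀C⟩ := exists_pos_forall_mul_rpow_le hC0 (sub_pos.2 hss)
  obtain ⟨n₁, hn₁⟩ := exists_nat_forall_mul_add_rpow_le hs (by linarith) hBB' hr₀
  have := hμ.finite
  obtain ⟨n, hn₁n, hn, G, hGU, hG⟩ := exists_gridCell_subset hμ.isOpen hμ.compl hμ.mass n₁
  have hn0 : (0 : ℝ) < n := by exact_mod_cast hn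
  set ℓ : ℝ := 1 / (2 * n) with hℓdef
  have hℓ : 0 < ℓ := by positivity
  have hℓn : ℓ + ℓ = 1 / n := by rw [hℓdef]; field_simp; norm_num
  choose N₀ hN₀ using fun ν : Fin m → ℤ => hS (gridCenter n ν) ℓ hℓ
  obtain ⟨N, hN2, hNn, hNG⟩ : ∃ N : ℕ, 2 ≤ N ∧ (n₀ : ℝ) ≤ κ * N ∧ ∀ ν ∈ G, N₀ ν ≤ N := by
    refine ⟨max (max 2 ⌈n₀ / κ⌉₊) (G.sup N₀), by omega, ?_, fun ν hν => ?_⟩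
    · have h1 : (n₀ : ℝ) / κ ≤ (max (max 2 ⌈n₀ / κ⌉₊) (G.sup N₀) : ℕ) :=
        (Nat.le_ceil _).trans (by exact_mod_cast (by omega))
      rw [div_le_iff₀ hκ] at h1
      linarith
    · exact (Finset.le_sup hν).trans (le_max_right _ _)
  choose! S hSq hSin hSsep hScard using fun ν hν => hN₀ ν N (hNG ν hν)
  have hN1 : (1 : ℝ) < N := by exact_mod_cast (by omega : 1 < N)
  have hN0 : (0 : ℝ) < N := by linarith
  set g : Fin m → ℝ := fun k => (N : ℝ) ^ (-(1 + min α (τ k))) with hg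
  set h : Fin m → ℝ := fun k => (N : ℝ) ^ (-(1 + τ k)) with hh
  have hh0 : ∀ k, 0 < h k := fun k => Real.rpow_pos_of_pos hN0 _
  have hgh : ∀ k, h k ≤ g k := fun k => Real.rpow_le_rpow_of_exponent_le hN1.le (by
    linarith [min_le_right α (τ k)])
  set V : ENNReal := ENNReal.ofReal (∏ k, (2 * h k)) with hV
  have hV0 : V ≠ 0 := by
    have : 0 < ∏ k, (2 * h k) := Finset.prod_pos fun k _ => by linarith [hh0 k]
    simpa [hV] using this
  have hVt : V ≠ ⊤ := ENNReal.ofReal_ne_top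
  let box : (Fin m → ℝ) → Set (Fin m → ℝ) := fun z => univ.pi fun k => Metric.ball (z k) (h k)
  have hboxopen : ∀ z, IsOpen (box z) := fun z =>
    isOpen_set_pi finite_univ fun k _ => Metric.isOpen_ball
  have hboxvol : ∀ z, volume (box z) = V := fun z => by
    simp only [box, hV]
    rw [volume_pi_pi, ENNReal.ofReal_prod_of_nonneg fun k _ => by linarith [hh0 k]]
    simp [Real.volume_ball]
  have hboxcell : ∀ ν ∈ G, ∀ z ∈ S ν, box z ⊆ Metric.closedBall (gridCenter n ν) ℓ := by
    intro ν hν z hz x hx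
    rw [Metric.mem_closedBall, dist_pi_le_iff hℓ.le]
    intro k
    have h1 := hx k (mem_univ _)
    rw [Metric.mem_ball] at h1
    have h2 := hSin ν hν z hz k
    have h3 := hgh k
    have h4 := dist_triangle (x k) (z k) (gridCenter n ν k)
    rw [← Real.dist_eq] at h2
    simp only [hg] at h3
    linarith
  have hcard0 : ∀ ν ∈ G, 0 < (S ν).card := fun ν hν => by
    have h1 := hScard ν hν
    have h2 : 0 < c * ℓ ^ m * (N : ℝ) ^ (m + 1 : ℝ) := by positivity
    exact_mod_cast h2.trans_le h1
  let w : (Fin m → ℤ) → ENNReal := fun ν => μ (gridCell n ν) / (S ν).card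
  have hwcard : ∀ ν ∈ G, (S ν).card * w ν = μ (gridCell n ν) := fun ν hν =>
    ENNReal.mul_div_cancel (by have := hcard0 ν hν; positivity) (ENNReal.natCast_ne_top _)
  have hwW : ∀ ν ∈ G, w ν ≤ ENNReal.ofReal (D * 2 ^ m / c * (N : ℝ) ^ (-(m + 1 : ℝ))) := by
    intro ν hν
    refine ENNReal.div_le_of_le_mul ?_
    refine (hD _).trans ((mul_le_mul_right (volume_gridCell_le hn ν) _).trans ?_)
    rw [← ENNReal.ofReal_mul hD0, ← ENNReal.ofReal_natCast (S ν).card,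
      ← ENNReal.ofReal_mul (by positivity)]
    refine ENNReal.ofReal_le_ofReal ?_
    calc D * (2 * ℓ) ^ m
        = D * 2 ^ m / c * (N : ℝ) ^ (-(m + 1 : ℝ)) * (c * ℓ ^ m * (N : ℝ) ^ (m + 1 : ℝ)) := by
          rw [Real.rpow_neg hN0.le, mul_pow]
          have := (Real.rpow_pos_of_pos hN0 (m + 1 : ℝ)).ne'
          field_simp
      _ ≤ _ := by
          gcongr
          exact hScard ν hν
  let μ' : Measure (Fin m → ℝ) := ∑ ν ∈ G, ∑ z ∈ S ν, w ν • V⁻¹ • volume.restrict (box z)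
  have hform : ∀ A, μ' A = ∑ ν ∈ G, ∑ z ∈ S ν, w ν * (V⁻¹ * volume (box z ∩ A)) := by
    intro A
    simp only [μ', Measure.finsetSum_apply, Measure.smul_apply, smul_eq_mul]
    refine Finset.sum_congr rfl fun ν _ => Finset.sum_congr rfl fun z _ => ?_
    rw [Measure.restrict_apply' (hboxopen z).measurableSet, inter_comm]
  have hterm : ∀ z A, V⁻¹ * volume (box z ∩ A) ≤ 1 := fun z A => by
    rw [← ENNReal.inv_mul_cancel hV0 hVt]
    refine mul_le_mul_right ?_ _
    rw [← hboxvol z]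
    exact measure_mono inter_subset_left
  have hmass : μ' univ = ∑ ν ∈ G, μ (gridCell n ν) := by
    rw [hform]
    refine Finset.sum_congr rfl fun ν hν => ?_
    simp only [inter_univ, hboxvol, ENNReal.inv_mul_cancel hV0 hVt, mul_one, Finset.sum_const,
      nsmul_eq_mul]
    exact hwcard ν hν
  have hfin : IsFiniteMeasure μ' := ⟨by
    rw [hmass]
    exact ENNReal.sum_lt_top.2 fun ν _ => measure_lt_top _ _⟩
  have hsep : ∀ i ∈ G.sigma S, ∀ j ∈ G.sigma S, i ≠ j →
      ∃ k, 2 * g k < |i.2 k - j.2 k| := by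
    rintro ⟨ν, z⟩ hi ⟨ν', z'⟩ hj hij
    obtain ⟨hν, hz⟩ := Finset.mem_sigma.1 hi
    obtain ⟨hν', hz'⟩ := Finset.mem_sigma.1 hj
    simp only at hν hz hν' hz' ⊢
    by_cases hνν : ν = ν'
    · subst hνν
      exact hSsep ν hν z hz z' hz' fun hzz => hij (by rw [hzz])
    · obtain ⟨k, hk⟩ := le_abs_gridCenter_sub hn hνν
      refine ⟨k, ?_⟩
      have h1 := hSin ν hν z hz k
      have h2 := hSin ν' hν' z' hz' k
      have h3 := abs_sub_le (gridCenter n ν k) (z k) (gridCenter n ν' k)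
      have h4 := abs_sub_le (z k) (z' k) (gridCenter n ν' k)
      rw [abs_sub_comm] at h1
      simp only [hg]
      linarith
  have hsmall : ∀ x r, 0 < r → r ≤ r₀ →
      μ' (Metric.closedBall x r) ≤ ENNReal.ofReal (B' * r ^ s) := by
    intro x r hr hrr
    have h1 := sum_volume_inter_closedBall_le (G.sigma S) (fun i => i.2) hh0 hgh hsep x hr
    rw [Finset.sum_sigma] at h1
    rw [hform]
    calc _ ≤ ∑ ν ∈ G, ∑ z ∈ S ν, ENNReal.ofReal (D * 2 ^ m / c * (N : ℝ) ^ (-(m + 1 : ℝ))) *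
            (V⁻¹ * volume (box z ∩ Metric.closedBall x r)) :=
          Finset.sum_le_sum fun ν hν => Finset.sum_le_sum fun z _ =>
            mul_le_mul_left (hwW ν hν) _
      _ ≤ ENNReal.ofReal (D * 2 ^ m / c * (N : ℝ) ^ (-(m + 1 : ℝ))) *
            ENNReal.ofReal (3 ^ m * ∏ k, (max (r / g k) 1 * min 1 (r / h k))) := by
          refine le_of_eq_of_le ?_ (mul_le_mul_right h1 _)
          simp only [Finset.mul_sum]
          rfl
      _ = ENNReal.ofReal (C * ((N : ℝ) ^ (-(m + 1 : ℝ)) *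
            ∏ k, (max (r * (N : ℝ) ^ (1 + min α (τ k))) 1 *
              min 1 (r * (N : ℝ) ^ (1 + τ k))))) := by
          rw [← ENNReal.ofReal_mul (by positivity)]
          simp only [hg, hh, Real.rpow_neg hN0.le, div_inv_eq_mul, hC]
          congr 1
          ring
      _ ≤ ENNReal.ofReal (B' * r ^ s) := by
          refine ENNReal.ofReal_le_ofReal ?_
          have h2 := prod_max_min_le hsm hH hα hN1 hr (hrr.trans hr₀1)
          calc _ ≤ C * r ^ s₀ := mul_le_mul_of_nonneg_left h2 hC0
            _ = C * r ^ (s₀ - s) * r ^ s := by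
                rw [mul_assoc C, ← Real.rpow_add hr, sub_add_cancel]
            _ ≤ B' * r ^ s := by
                refine mul_le_mul_of_nonneg_right ?_ (by positivity)
                linarith [hr₀C r hr hrr]
  have hlarge : ∀ x r, r₀ ≤ r →
      μ' (Metric.closedBall x r) ≤ ENNReal.ofReal (B' * r ^ s) := by
    intro x r hr
    have hr0 : 0 < r := hr₀.trans_le hr
    rw [hform]
    calc _ ≤ ∑ ν ∈ G, μ (gridCell n ν ∩ Metric.closedBall x (r + 1 / n)) := by
          refine Finset.sum_le_sum fun ν hν => ?_
          by_cases hne :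
            (Metric.closedBall (gridCenter n ν) ℓ ∩ Metric.closedBall x r).Nonempty
          · obtain ⟨y, hy1, hy2⟩ := hne
            have h1 : gridCell n ν ⊆ Metric.closedBall x (r + 1 / n) := by
              refine (gridCell_subset hn ν).trans (Metric.closedBall_subset_closedBall' ?_)
              rw [Metric.mem_closedBall] at hy1 hy2
              have := dist_triangle_left (gridCenter n ν) x y
              linarith
            rw [inter_eq_left.2 h1, ← hwcard ν hν, ← nsmul_eq_mul, ← Finset.sum_const]
            exact Finset.sum_le_sum fun z _ => mul_le_of_le_one_right' (hterm z _)
          · refine (Finset.sum_eq_zero fun z hz => ?_).trans_le bot_le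
            have h1 : box z ∩ Metric.closedBall x r = ∅ :=
              Set.subset_eq_empty (inter_subset_inter_left _ (hboxcell ν hν z hz))
                (Set.not_nonempty_iff_eq_empty.1 hne)
            rw [h1, measure_empty, mul_zero, mul_zero]
      _ = μ (⋃ ν ∈ G, gridCell n ν ∩ Metric.closedBall x (r + 1 / n)) := by
          rw [measure_biUnion_finset]
          · intro ν _ ν' _ hνν
            exact (pairwise_disjoint_gridCell m n hνν).mono inter_subset_left inter_subset_left
          · exact fun ν _ =>
              (measurableSet_gridCell ν).inter Metric.isClosed_closedBall.measurableSet
      _ ≤ μ (Metric.closedBall x (r + 1 / n)) :=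
          measure_mono (iUnion₂_subset fun ν _ => inter_subset_right)
      _ ≤ ENNReal.ofReal (B * (r + 1 / n) ^ s) := hμ.ball _ _ (by positivity)
      _ ≤ _ := ENNReal.ofReal_le_ofReal (hn₁ n hn₁n r hr)
  refine ⟨μ', ⋃ ν ∈ G, ⋃ z ∈ S ν, box z, ⟨hfin, ?_, ?_, ?_, ?_, ?_⟩, ?_, ?_⟩
  · refine ⟨(∑ ν ∈ G, ∑ z ∈ S ν, w ν * V⁻¹).toReal, ENNReal.toReal_nonneg, fun A => ?_⟩
    rw [ENNReal.ofReal_toReal, hform, Finset.sum_mul]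
    · refine Finset.sum_le_sum fun ν _ => ?_
      rw [Finset.sum_mul]
      refine Finset.sum_le_sum fun z _ => ?_
      rw [mul_assoc]
      gcongr
      exact inter_subset_right
    · refine (ENNReal.sum_lt_top.2 fun ν hν => ENNReal.sum_lt_top.2 fun z _ => ?_).ne
      exact ENNReal.mul_lt_top ((hwW ν hν).trans_lt ENNReal.ofReal_lt_top)
        (ENNReal.inv_lt_top.2 (pos_iff_ne_zero.2 hV0))
  · exact isOpen_biUnion fun ν _ => isOpen_biUnion fun z _ => hboxopen z
  · rw [hform]
    refine Finset.sum_eq_zero fun ν hν => Finset.sum_eq_zero fun z hz => ?_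
    have h1 : box z ∩ (⋃ ν ∈ G, ⋃ z ∈ S ν, box z)ᶜ = ∅ := by
      rw [← Set.disjoint_iff_inter_eq_empty, Set.disjoint_compl_right_iff_subset]
      intro x hx
      exact mem_iUnion₂.2 ⟨ν, hν, mem_iUnion₂.2 ⟨z, hz, hx⟩⟩
    rw [h1, measure_empty, mul_zero, mul_zero]
  · rw [hmass]
    exact hG
  · intro x r hr
    rcases le_total r r₀ with h1 | h1
    · exact hsmall x r hr h1
    · exact hlarge x r h1
  · refine (closure_minimal (iUnion₂_subset fun ν hν => ?_)
      (isClosed_biUnion_finset (s := G) fun ν _ =>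
        Metric.isClosed_closedBall (x := gridCenter n ν) (ε := ℓ))).trans
      (iUnion₂_subset fun ν hν => hGU ν hν)
    refine iUnion₂_subset fun z hz => (hboxcell ν hν z hz).trans ?_
    exact subset_biUnion_of_mem (u := fun ν => Metric.closedBall (gridCenter n ν) ℓ) hν
  · intro x hx
    obtain ⟨ν, hν, hx⟩ := mem_iUnion₂.1 hx
    obtain ⟨z, hz, hx⟩ := mem_iUnion₂.1 hx
    obtain ⟨q, p, hq1, hq2, hq3, hzp⟩ := hSq ν hν z hz
    refine ⟨q, by exact_mod_cast hNn.trans hq1, hq3, p, fun k => ?_⟩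
    refine abs_mul_sub_lt_psiTau hq3 hq2 k (hpos k) ?_
    rw [← hzp k]
    exact hx k (mem_univ _)

lemma isFrostmanOn_restrict_pi_Ioo {m : ℕ} {s : ℝ} (hs : 0 < s) (hsm : s ≤ m) :
    IsFrostmanOn s (2 * 2 ^ m) ((2 : ENNReal) • volume.restrict (univ.pi fun _ : Fin m => Ioo 0 1))
      (univ.pi fun _ : Fin m => Ioo 0 1) := by
  have hopen : IsOpen (univ.pi fun _ : Fin m => Ioo (0 : ℝ) 1) :=
    isOpen_set_pi finite_univ fun _ _ => isOpen_Ioo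
  have hvol : volume (univ.pi fun _ : Fin m => Ioo (0 : ℝ) 1) = 1 := by
    simp [volume_pi_pi]
  have hmass : ((2 : ENNReal) • volume.restrict (univ.pi fun _ : Fin m => Ioo (0 : ℝ) 1)) univ
      = 2 := by
    rw [Measure.smul_apply, Measure.restrict_apply_univ, hvol, smul_eq_mul, mul_one]
  refine ⟨⟨by rw [hmass]; exact ENNReal.ofNat_lt_top⟩, ⟨2, zero_le_two, fun A => ?_⟩, hopen, ?_,
    by rw [hmass]; exact ENNReal.one_lt_two, fun x r hr => ?_⟩
  · rw [Measure.smul_apply, smul_eq_mul, ENNReal.ofReal_ofNat]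
    exact mul_le_mul_right (Measure.restrict_le_self A) _
  · rw [Measure.smul_apply, Measure.restrict_apply hopen.measurableSet.compl, compl_inter_self,
      measure_empty, smul_zero]
  · rcases le_total r 1 with h1 | h1
    · rw [Measure.smul_apply, smul_eq_mul, mul_assoc, ENNReal.ofReal_mul zero_le_two,
        ENNReal.ofReal_ofNat]
      refine mul_le_mul_right ((Measure.restrict_le_self _).trans ?_) _
      rw [closedBall_pi _ hr.le, volume_pi_closedBall_eq _ fun _ => hr.le]
      refine ENNReal.ofReal_le_ofReal ?_
      rw [Finset.prod_const, Finset.card_univ, Fintype.card_fin, mul_pow]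
      gcongr
      rw [← Real.rpow_natCast]
      exact Real.rpow_le_rpow_of_exponent_ge hr h1 hsm
    · refine (measure_mono (subset_univ _)).trans ?_
      rw [hmass, ← ENNReal.ofReal_ofNat]
      refine ENNReal.ofReal_le_ofReal ?_
      have h2 : 1 ≤ r ^ s := Real.one_le_rpow h1 hs.le
      have h3 : (1 : ℝ) ≤ 2 ^ m := one_le_pow₀ one_le_two
      nlinarith

lemma le_dimH_approxSet {m : ℕ} {τ : Fin m → ℝ} (hpos : ∀ i, 0 < τ i)
    (hsum : 1 < ∑ i, τ i) {s s₀ : ℝ} (hs : 0 < s) (hss : s < s₀) (hsm : s₀ ≤ m)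
    (hH : ∀ i, s₀ * (1 + τ i) ≤ m + 1 + ∑ k, max (τ i - τ k) 0) :
    ENNReal.ofReal s ≤ dimH (approxSet m (psiTau m τ)) := by
  set b : ℕ → ℝ := fun n => 2 * 2 ^ m * (2 - 1 / (n + 1)) with hb
  have hb1 : ∀ n, 1 ≤ b n := fun n => by
    have h1 : 1 / ((n : ℝ) + 1) ≤ 1 := by
      rw [div_le_one (by positivity)]; linarith [Nat.cast_nonneg (α := ℝ) n]
    have h2 : (1 : ℝ) ≤ 2 ^ m := one_le_pow₀ one_le_two
    simp only [hb]
    nlinarith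
  have hblt : ∀ n, b n < b (n + 1) := fun n => by
    simp only [hb]
    have h1 : 1 / (((n + 1 : ℕ) : ℝ) + 1) < 1 / ((n : ℝ) + 1) := by
      apply one_div_lt_one_div_of_lt <;> push_cast <;> linarith [Nat.cast_nonneg (α := ℝ) n]
    gcongr
  have hb2 : ∀ n, b n ≤ 4 * 2 ^ m := fun n => by
    have h1 : 0 ≤ 1 / ((n : ℝ) + 1) := by positivity
    have h2 : (1 : ℝ) ≤ 2 ^ m := one_le_pow₀ one_le_two
    simp only [hb]
    nlinarith
  let X : ℕ → Type := fun n =>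
    {p : Measure (Fin m → ℝ) × Set (Fin m → ℝ) // IsFrostmanOn s (b n) p.1 p.2}
  have hstep : ∀ n (p : X n), ∃ p' : X (n + 1), closure p'.1.2 ⊆ p.1.2 ∧ ∀ x ∈ p'.1.2,
      ∃ q : ℕ, n ≤ q ∧ 0 < q ∧
        ∃ p : Fin m → ℤ, ∀ k, |(q : ℝ) * x k - p k| < psiTau m τ q k := by
    intro n p
    obtain ⟨μ', U', h1, h2⟩ :=
      p.2.exists_next hpos hsum hs hss hsm hH (hb1 n) (hblt n) n
    exact ⟨⟨(μ', U'), h1⟩, h2⟩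
  choose F hF using hstep
  have hstart : IsFrostmanOn s (b 0)
      ((2 : ENNReal) • volume.restrict (univ.pi fun _ : Fin m => Ioo (0 : ℝ) 1))
      (univ.pi fun _ : Fin m => Ioo 0 1) := by
    have h1 : b 0 = 2 * 2 ^ m := by simp only [hb]; norm_num
    rw [h1]
    exact isFrostmanOn_restrict_pi_Ioo hs (hss.le.trans hsm)
  let P : ∀ n, X n := fun n => Nat.rec ⟨(_, _), hstart⟩ (fun n p => F n p) n
  have hP : ∀ n, P (n + 1) = F n (P n) := fun _ => rfl
  have hsub : ∀ n, closure (P (n + 1)).1.2 ⊆ (P n).1.2 := fun n => by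
    rw [hP]; exact (hF n (P n)).1
  have hanti : Antitone fun n => closure (P n).1.2 :=
    antitone_nat_of_succ_le fun n => (hsub n).trans subset_closure
  have hK0 : closure (P 0).1.2 ⊆ Icc 0 1 := by
    refine closure_minimal (fun x hx => ?_) isClosed_Icc
    exact ⟨fun k => (hx k (mem_univ _)).1.le, fun k => (hx k (mem_univ _)).2.le⟩
  have hK : ∀ n, IsCompact (closure (P n).1.2) := fun n =>
    isCompact_Icc.of_isClosed_subset isClosed_closure ((hanti (Nat.zero_le n)).trans hK0)
  have hne := hausdorffMeasure_iInter_ne_zero hs hanti hK (fun n => (P n).1.1)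
    (fun n => measure_mono_null (compl_subset_compl.2 subset_closure) (P n).2.compl)
    (B := 4 * 2 ^ m) (by positivity)
    (fun n x r hr => ((P n).2.ball x r hr).trans (ENNReal.ofReal_le_ofReal (by
      gcongr
      exact hb2 n)))
    fun n => (P n).2.mass.le
  have hsubset : ⋂ n, closure (P n).1.2 ⊆ approxSet m (psiTau m τ) := by
    intro x hx
    rw [mem_iInter] at hx
    refine ⟨fun i => ⟨(hK0 (hx 0)).1 i, (hK0 (hx 0)).2 i⟩, ?_⟩
    refine Set.infinite_of_forall_exists_gt fun n => ?_
    have h1 : x ∈ (F (n + 1) (P (n + 1))).1.2 := by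
      rw [← hP]; exact hsub (n + 2) (hx (n + 3))
    obtain ⟨q, hq1, hq2, hq3⟩ := (hF (n + 1) (P (n + 1))).2 x h1
    exact ⟨q, ⟨hq2, hq3⟩, hq1⟩
  have hne' : μH[(s.toNNReal : ℝ)] (⋂ n, closure (P n).1.2) ≠ 0 := by
    rwa [Real.coe_toNNReal _ hs.le]
  exact (le_dimH_of_hausdorffMeasure_ne_zero hne').trans (dimH_mono hsubset)

lemma sum_Ici_sub_eq_sum_max {m : ℕ} {τ : Fin m → ℝ} (hmono : ∀ i j : Fin m, i ≤ j → τ j ≤ τ i)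
    (i : Fin m) : ∑ k ∈ Finset.Ici i, (τ i - τ k) = ∑ k, max (τ i - τ k) 0 := by
  rw [← Finset.sum_subset (Finset.subset_univ (Finset.Ici i))]
  · refine Finset.sum_congr rfl fun k hk => (max_eq_left ?_).symm
    linarith [hmono i k (Finset.mem_Ici.1 hk)]
  · intro k _ hk
    have := hmono k i (le_of_not_ge fun h => hk (Finset.mem_Ici.2 h))
    exact max_eq_right (by linarith)

/-- Rynne–Dickinson: for `τ1 ≥ τ2 ≥ ⋯ ≥ τm > 0` with `τ1 + ⋯ + τm > 1`,
`dim_H A_m(Ψ_τ) = min_{1 ≤ i ≤ m} (m + 1 + Σ_{k=i}^m (τ_i − τ_k)) / (1 + τ_i)`. -/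
theorem stmt13 (m : ℕ) (hm : 1 ≤ m) (τ : Fin m → ℝ)
    (hmono : ∀ i j : Fin m, i ≤ j → τ j ≤ τ i) (hpos : ∀ i, 0 < τ i)
    (hsum : 1 < ∑ i, τ i) :
    dimH (approxSet m (psiTau m τ)) =
      ENNReal.ofReal (⨅ i : Fin m,
        ((m : ℝ) + 1 + ∑ k ∈ Finset.Ici i, (τ i - τ k)) / (1 + τ i)) := by
  have : Nonempty (Fin m) := ⟨⟨0, hm⟩⟩
  simp only [sum_Ici_sub_eq_sum_max hmono]
  set d : Fin m → ℝ := fun i => ((m : ℝ) + 1 + ∑ k, max (τ i - τ k) 0) / (1 + τ i) with hd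
  obtain ⟨i₀, hi₀⟩ := exists_eq_ciInf_of_finite (f := d)
  have hle : ∀ i, d i₀ ≤ d i := fun i => by
    rw [hi₀]; exact ciInf_le (Set.finite_range d).bddBelow i
  have hH : ∀ i, d i₀ * (1 + τ i) ≤ m + 1 + ∑ k, max (τ i - τ k) 0 := fun i =>
    (le_div_iff₀ (by linarith [hpos i])).1 (hle i)
  have hd0 : 0 < d i₀ := by
    have h1 : 0 ≤ ∑ k, max (τ i₀ - τ k) 0 := Finset.sum_nonneg fun k _ => le_max_right _ _
    have := hpos i₀
    simp only [hd]
    positivity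
  have hdm : d i₀ ≤ m := by
    set j : Fin m := ⟨0, hm⟩ with hj
    refine (hle j).trans ?_
    rw [hd, div_le_iff₀ (by linarith [hpos j])]
    have h1 : ∑ k, max (τ j - τ k) 0 = m * τ j - ∑ k, τ k := by
      rw [Finset.sum_congr rfl fun k _ => max_eq_left (sub_nonneg.2 (hmono j k (Fin.mk_le_of_le_val
        (Nat.zero_le _)))), Finset.sum_sub_distrib]
      simp
    rw [h1]
    linarith
  rw [← hi₀]
  refine le_antisymm (dimH_approxSet_le hpos i₀) ?_
  refine le_of_forall_lt fun a ha => ?_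
  obtain ⟨s, hs1, hs2⟩ := ENNReal.lt_iff_exists_nnreal_btwn.1 ha
  have hs0 : 0 < s := ENNReal.coe_pos.1 (bot_le.trans_lt hs1)
  have hsd : (s : ℝ) < d i₀ := by
    rw [← ENNReal.ofReal_coe_nnreal] at hs2
    exact (ENNReal.ofReal_lt_ofReal_iff hd0).1 hs2
  refine hs1.trans_le ?_
  rw [← ENNReal.ofReal_coe_nnreal]
  exact le_dimH_approxSet hpos hsum (by exact_mod_cast hs0) hsd hdm hH
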